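/- Let Ω be a canonical ideal of A with I ⊆ Ω. Then the R-module ((I^{[p]} : I) ∩ (Ω^{[p]} : Ω)) / I^{[p]} is cyclic; that is, there exists u ∈ R with (I^{[p]} : I) ∩ (Ω^{[p]} : Ω) = I^{[p]} + (u). -/

import Mathlib

/-- `𝔞^{[q]}`: the ideal generated by the `q`-th powers of all elements of `𝔞`. -/
def frobPow {R : Type} [CommRing R] (q : ℕ) (a : Ideal R) : Ideal R :=
  Ideal.span ((fun x => x ^ q) '' (a : Set R))

noncomputable def extModule (R : Type) [CommRing R] (e : ℕ) (M N : Type) [AddCommGroup M]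
    [AddCommGroup N] [Module R M] [Module R N] : ModuleCat R :=
  ((Ext R (ModuleCat R) e).obj (Opposite.op (ModuleCat.of R M))).obj (ModuleCat.of R N)

/-- `Ω` is a canonical ideal of `A = R/I`: `I ⊆ Ω ⊆ R` and `Ω/I ≅ Ext_R^e(R/I, R)`,
where `e = n - d`. -/
def IsCanonicalIdeal (R : Type) [CommRing R] (e : ℕ) (I Ω : Ideal R) : Prop :=
  I ≤ Ω ∧ Nonempty
    ((↥Ω ⧸ (Submodule.comap Ω.subtype (I : Submodule R R))) ≃ₗ[R] extModule R e (R ⧸ I) R)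

def IsCohenMacaulayLocalOfDim (A : Type) [CommRing A] (m : Ideal A) (d : ℕ) : Prop :=
  ringKrullDim A = d ∧
    ∃ rs : List A, rs.length = d ∧ (∀ x ∈ rs, x ∈ m) ∧ RingTheory.Sequence.IsRegular A rs

open MvPowerSeries in
theorem MvPowerSeries.mem_span_X_pow_iff {σ k : Type*} [CommRing k] (N : ℕ)
    (T : Finset σ) (f : MvPowerSeries σ k) :
    f ∈ Ideal.span ((fun j => (X j : MvPowerSeries σ k) ^ N) '' (T : Set σ)) ↔
      ∀ m : σ →₀ ℕ, (∀ j ∈ T, m j < N) → coeff m f = 0 := by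
  classical
  constructor
  · intro hf
    induction hf using Submodule.span_induction with
    | mem x hx =>
      obtain ⟨j, hj, rfl⟩ := hx
      intro m hm
      exact X_pow_dvd_iff.mp dvd_rfl m (hm j hj)
    | zero => simp
    | add x y _ _ hx hy => exact fun m hm => by rw [map_add, hx m hm, hy m hm, add_zero]
    | smul a x _ hx =>
      intro m hm
      rw [smul_eq_mul, coeff_mul]
      refine Finset.sum_eq_zero fun q hq => ?_
      have hqm : q.2 ≤ m := by
        rw [← Finset.HasAntidiagonal.mem_antidiagonal.mp hq]; exact le_add_self
      rw [hx q.2 fun j hj => (hqm j).trans_lt (hm j hj), mul_zero]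
  · induction T using Finset.induction_on generalizing f with
    | empty =>
      intro h
      have : f = 0 := by ext m; simpa using h m
      simp [this]
    | insert i T hi ih =>
      intro h
      let f₁ : MvPowerSeries σ k := fun m => if m i < N then 0 else coeff m f
      have h₁ : (X i : MvPowerSeries σ k) ^ N ∣ f₁ := by
        rw [X_pow_dvd_iff]
        intro m hm
        change (if m i < N then 0 else coeff m f) = 0
        rw [if_pos hm]
      have h₂ := ih (f - f₁) fun m hm => by
        rw [map_sub]
        change coeff m f - (if m i < N then 0 else coeff m f) = 0
        split_ifs with hmi
        · rw [sub_zero]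
          refine h m fun j hj => ?_
          rcases Finset.mem_insert.mp hj with rfl | hj
          exacts [hmi, hm j hj]
        · simp
      rw [← sub_add_cancel f f₁]
      refine add_mem (Ideal.span_mono (Set.image_mono (by simp)) h₂) ?_
      exact Ideal.mem_of_dvd _ h₁ (Ideal.subset_span ⟨i, by simp, rfl⟩)

theorem MvPowerSeries.mem_maximalIdeal_iff {σ k : Type*} [Field k] (f : MvPowerSeries σ k) :
    f ∈ IsLocalRing.maximalIdeal (MvPowerSeries σ k) ↔ constantCoeff f = 0 := by
  rw [IsLocalRing.mem_maximalIdeal, mem_nonunits_iff, isUnit_iff_constantCoeff,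
    isUnit_iff_ne_zero, not_not]

theorem MvPowerSeries.span_X_pow_le {σ k : Type*} [Field k] [Fintype σ] (N : ℕ) :
    Ideal.span ((fun j => (X j : MvPowerSeries σ k) ^ N) '' (Finset.univ : Finset σ)) ≤
      IsLocalRing.maximalIdeal (MvPowerSeries σ k) ^ N := by
  rw [Ideal.span_le]
  rintro _ ⟨j, -, rfl⟩
  exact Ideal.pow_mem_pow ((mem_maximalIdeal_iff _).mpr (by simp)) N

universe u in
theorem exists_frobenius_coordinates (p : ℕ) [hp : Fact p.Prime] (k : Type u) [Field k]
    [CharP k p] : ∃ (ι : Type u) (β : ι → k) (φ : ι → k →+ k), (∀ i a c, φ i (a ^ p * c) = a * φ i c) ∧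
      ∀ c, ∃ s : Finset ι, ∀ t, s ⊆ t → ∑ i ∈ t, β i * φ i c ^ p = c := by
  classical
  let K := (frobenius k p).fieldRange
  let e : k ≃+* K := RingEquiv.ofBijective (frobenius k p).rangeRestrictField
    ⟨(frobenius k p).rangeRestrictField.injective, fun ⟨_, a, ha⟩ => ⟨a, Subtype.ext ha⟩⟩
  have he : ∀ a, (e a : k) = a ^ p := fun a => rfl
  have he' : ∀ x : K, (e.symm x) ^ p = (x : k) := fun x => by rw [← he, e.apply_symm_apply]
  let b := Module.Basis.ofVectorSpace K k
  refine ⟨_, b, fun i => (e.symm : K →+ k).comp (b.coord i).toAddMonoidHom, ?_, fun c =>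
    ⟨(b.repr c).support, fun t ht => ?_⟩⟩
  · intro i a c
    have : a ^ p * c = e a • c := by rw [Algebra.smul_def]; rfl
    simp [this]
  · conv_rhs => rw [← b.linearCombination_repr c, Finsupp.linearCombination_apply,
      Finsupp.sum_of_support_subset _ ht _ (by simp)]
    refine Finset.sum_congr rfl fun i _ => ?_
    simp only [AddMonoidHom.coe_comp, Function.comp_apply, AddMonoidHom.coe_coe,
      LinearMap.toAddMonoidHom_coe, Module.Basis.coord_apply, Algebra.smul_def]
    rw [mul_comm]
    exact congrArg (· * b i) (he' _)

open MvPowerSeries in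
theorem MvPowerSeries.coeff_pow_char {σ k : Type*} [Finite σ] (p : ℕ) [hp : Fact p.Prime]
    [CommRing k] [CharP k p] (f : MvPowerSeries σ k) (m : σ →₀ ℕ) :
    coeff (p • m) (f ^ p) = coeff m f ^ p := by
  rw [← map_frobenius_expand p hp.out.ne_zero, coeff_map, coeff_expand_smul, frobenius_def]

open MvPowerSeries in
theorem MvPowerSeries.coeff_pow_char_eq_zero {σ k : Type*} [Finite σ] (p : ℕ) [hp : Fact p.Prime]
    [CommRing k] [CharP k p] (f : MvPowerSeries σ k) (m : σ →₀ ℕ) (i : σ) (h : ¬ p ∣ m i) :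
    coeff m (f ^ p) = 0 := by
  rw [← map_frobenius_expand p hp.out.ne_zero, coeff_map, coeff_expand_of_not_dvd _ _ _ h,
    map_zero]

/-- The `p⁻¹`-linear operator on power series extracting the coefficients at exponents `p • m + e`,
each transformed by `φ`. -/
noncomputable def MvPowerSeries.cartier {σ k : Type*} [Semiring k] (p : ℕ) (φ : k →+ k)
    (e : σ →₀ ℕ) : MvPowerSeries σ k →+ MvPowerSeries σ k where
  toFun f := fun m => φ (coeff (p • m + e) f)
  map_zero' := by ext m; exact (congrArg φ (map_zero _)).trans (map_zero φ)
  map_add' f g := by ext m; exact (congrArg φ (map_add _ f g)).trans (map_add φ _ _)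

open MvPowerSeries in
theorem MvPowerSeries.coeff_cartier {σ k : Type*} [Semiring k] (p : ℕ) (φ : k →+ k) (e : σ →₀ ℕ)
    (f : MvPowerSeries σ k) (m : σ →₀ ℕ) :
    coeff m (cartier p φ e f) = φ (coeff (p • m + e) f) := rfl

open MvPowerSeries in
theorem MvPowerSeries.cartier_pow_mul {σ k : Type*} [Finite σ] (p : ℕ) [hp : Fact p.Prime]
    [CommRing k] [CharP k p] (φ : k →+ k) (hφ : ∀ a c, φ (a ^ p * c) = a * φ c) (e : σ →₀ ℕ)
    (he : ∀ j, e j < p) (a f : MvPowerSeries σ k) :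
    cartier p φ e (a ^ p * f) = a * cartier p φ e f := by
  classical
  ext m
  rw [coeff_cartier, coeff_mul, coeff_mul, map_sum]
  symm
  refine Finset.sum_of_injOn (fun q => (p • q.1, p • q.2 + e)) ?_ ?_ ?_ ?_
  · rintro ⟨a, b⟩ - ⟨c, d⟩ - h
    have h1 := congrArg Prod.fst h
    have h2 := congrArg Prod.snd h
    simp only [add_left_inj] at h1 h2
    have inj : Function.Injective fun x : σ →₀ ℕ => p • x := smul_right_injective _ hp.out.ne_zero
    exact Prod.ext (inj h1) (inj h2)
  · rintro ⟨a, b⟩ h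
    simp only [Finset.mem_coe, Finset.HasAntidiagonal.mem_antidiagonal] at h ⊢
    rw [← h, smul_add, add_assoc]
  · rintro ⟨x, y⟩ hxy hn
    rw [Finset.HasAntidiagonal.mem_antidiagonal] at hxy
    dsimp only at hxy ⊢
    by_cases hx : ∀ j, p ∣ x j
    · exfalso
      apply hn
      choose l hl using hx
      have hle : ∀ j, l j ≤ m j := fun j => by
        have h1 := DFunLike.congr_fun hxy j
        have h2 := he j
        simp only [Finsupp.add_apply, Finsupp.smul_apply, smul_eq_mul, hl] at h1
        by_contra! hlt
        have : p * (m j + 1) ≤ p * l j := Nat.mul_le_mul_left p hlt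
        rw [mul_add] at this
        omega
      let l' : σ →₀ ℕ := Finsupp.equivFunOnFinite.symm l
      have hl' : x = p • l' := by ext j; simp [l', hl]
      have hlm : l' ≤ m := hle
      refine ⟨(l', m - l'), ?_, ?_⟩
      · simp [hlm]
      · refine Prod.ext hl'.symm ?_
        have : m = l' + (m - l') := (add_tsub_cancel_of_le hlm).symm
        rw [this, hl', smul_add, add_assoc] at hxy
        exact (add_left_cancel hxy).symm
    · push Not at hx
      obtain ⟨j, hj⟩ := hx
      rw [coeff_pow_char_eq_zero p _ _ j hj, zero_mul, map_zero]
  · rintro ⟨x, y⟩ -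
    dsimp only
    rw [coeff_pow_char, hφ, coeff_cartier]

open MvPowerSeries in
theorem MvPowerSeries.coeff_monomial_mul_pow_char {σ k : Type*} [Finite σ] (p : ℕ)
    [hp : Fact p.Prime] [CommRing k] [CharP k p] (e e' m : σ →₀ ℕ) (he : ∀ j, e j < p)
    (he' : ∀ j, e' j < p) (b : k) (f : MvPowerSeries σ k) [Decidable (e = e')] :
    coeff (p • m + e') (monomial e b * f ^ p) = if e = e' then b * coeff m f ^ p else 0 := by
  classical
  rw [coeff_monomial_mul]
  split_ifs with hle h h
  · subst h
    rw [add_tsub_cancel_right, coeff_pow_char]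
  · obtain ⟨j, hj⟩ : ∃ j, e j ≠ e' j := by
      by_contra! hc; exact h (Finsupp.ext hc)
    rw [coeff_pow_char_eq_zero p _ _ j, mul_zero]
    have h1 := hle j
    simp only [Finsupp.coe_tsub, Finsupp.coe_add, Finsupp.coe_smul, Pi.sub_apply, Pi.add_apply,
      Pi.smul_apply, smul_eq_mul] at h1 ⊢
    rintro ⟨l, hl⟩
    apply hj
    have h2 : p * m j + e' j = p * l + e j := by omega
    have h3 := congrArg (· % p) h2
    simp only [Nat.mul_add_mod] at h3
    rw [Nat.mod_eq_of_lt (he j), Nat.mod_eq_of_lt (he' j)] at h3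
    exact h3.symm
  · exact absurd (h ▸ le_add_self) hle
  · rfl

universe u in
open MvPowerSeries in
theorem MvPowerSeries.exists_finite_frobenius_expansion {σ k : Type u} {β : Type*} [Finite σ]
    [Finite β] (p : ℕ) [hp : Fact p.Prime] [Field k] [CharP k p] (v : β → MvPowerSeries σ k)
    (N : ℕ) :
    ∃ (κ : Type u) (_ : Fintype κ) (c : κ → MvPowerSeries σ k)
      (C : κ → MvPowerSeries σ k →+ MvPowerSeries σ k),
      (∀ i a f, C i (a ^ p * f) = a * C i f) ∧
      ∀ j (M : σ →₀ ℕ), (∀ l, M l < N) → coeff M (∑ i, c i * C i (v j) ^ p) = coeff M (v j) := by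
  classical
  have := Fintype.ofFinite σ
  have := Fintype.ofFinite β
  obtain ⟨ι, b, φ, hφ, hb⟩ := exists_frobenius_coordinates p k
  choose s hs using hb
  let box (N : ℕ) : Finset (σ →₀ ℕ) := Finset.Iic (Finsupp.equivFunOnFinite.symm fun _ => N)
  let E : Finset (σ →₀ ℕ) := (box p).filter fun e => ∀ j, e j < p
  let t : Finset ι := (box N).biUnion fun M => Finset.univ.biUnion fun j => s (coeff M (v j))
  refine ⟨E × t, inferInstance, fun i => monomial i.1.1 (b i.2.1),
    fun i => cartier p (φ i.2.1) i.1.1, fun i a f => ?_, fun j M hM => ?_⟩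
  · exact cartier_pow_mul p _ (hφ _) _ (Finset.mem_filter.mp i.1.2).2 a f
  · let e' : σ →₀ ℕ := Finsupp.equivFunOnFinite.symm fun j => M j % p
    let m : σ →₀ ℕ := Finsupp.equivFunOnFinite.symm fun j => M j / p
    have hMe : M = p • m + e' := by
      ext l; exact (Nat.div_add_mod (M l) p).symm
    have he' : ∀ l, e' l < p := fun l => Nat.mod_lt _ hp.out.pos
    have he'E : e' ∈ E := by
      refine Finset.mem_filter.mpr ⟨Finset.mem_Iic.mpr fun l => (he' l).le, he'⟩
    have hst : s (coeff M (v j)) ⊆ t := by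
      intro x hx
      simp only [t, Finset.mem_biUnion]
      exact ⟨M, Finset.mem_Iic.mpr fun l => (hM l).le, j, Finset.mem_univ _, hx⟩
    rw [← hs (coeff M (v j)) t hst, map_sum, Fintype.sum_prod_type, Finset.sum_eq_single ⟨e', he'E⟩,
      ← Finset.sum_coe_sort t]
    · refine Finset.sum_congr rfl fun i _ => ?_
      dsimp only
      conv_lhs => rw [hMe]
      rw [coeff_monomial_mul_pow_char p e' e' m he' he', if_pos rfl, coeff_cartier, ← hMe]
    · intro e _ hne
      refine Finset.sum_eq_zero fun i _ => ?_
      dsimp only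
      rw [hMe, coeff_monomial_mul_pow_char p e.1 e' m (Finset.mem_filter.mp e.2).2 he',
        if_neg fun h => hne (Subtype.ext h)]
    · simp

/-- Flatness of the Frobenius endomorphism of a power series ring, in equational form. -/
theorem MvPowerSeries.mem_span_pow_of_mulVec_eq_zero {σ k : Type} [Finite σ] {α β : Type*}
    [Fintype β] (p : ℕ) [hp : Fact p.Prime] [Field k] [CharP k p]
    (U : Matrix α β (MvPowerSeries σ k)) (v : β → MvPowerSeries σ k)
    (hv : (U.map (· ^ p)).mulVec v = 0) :
    v ∈ Submodule.span (MvPowerSeries σ k)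
      {w : β → MvPowerSeries σ k | ∃ s, U.mulVec s = 0 ∧ w = fun j => s j ^ p} := by
  classical
  have := Fintype.ofFinite σ
  set S := Submodule.span (MvPowerSeries σ k)
      {w : β → MvPowerSeries σ k | ∃ s, U.mulVec s = 0 ∧ w = fun j => s j ^ p}
  have key : ∀ N, S.mkQ v ∈ (IsLocalRing.maximalIdeal (MvPowerSeries σ k) ^ N •
      (⊤ : Submodule (MvPowerSeries σ k) ((β → MvPowerSeries σ k) ⧸ S))) := by
    intro N
    obtain ⟨κ, _, c, C, hC, hcC⟩ := exists_finite_frobenius_expansion p v N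
    have h1 : (fun j => ∑ i, c i * C i (v j) ^ p) ∈ S := by
      have : (fun j => ∑ i, c i * C i (v j) ^ p) = ∑ i, c i • (fun j => C i (v j) ^ p) := by
        ext1 j; simp
      rw [this]
      refine sum_mem fun i _ => S.smul_mem _ (Submodule.subset_span ⟨fun j => C i (v j), ?_, rfl⟩)
      ext1 a
      have h2 := congrArg (C i) (congrFun hv a)
      simpa [Matrix.mulVec, dotProduct, hC] using h2
    have h2 : S.mkQ v = S.mkQ (v - fun j => ∑ i, c i * C i (v j) ^ p) := by
      rw [map_sub, sub_eq_self.mpr]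
      simpa using h1
    rw [h2, pi_eq_sum_univ (v - fun j => ∑ i, c i * C i (v j) ^ p), map_sum]
    refine sum_mem fun j _ => ?_
    rw [map_smul]
    refine Submodule.smul_mem_smul (span_X_pow_le N ?_) trivial
    rw [mem_span_X_pow_iff]
    intro M hM
    rw [Pi.sub_apply, map_sub, hcC j M fun l => hM l (Finset.mem_univ l), sub_self]
  have h0 := Ideal.iInf_pow_smul_eq_bot_of_isLocalRing
    (M := (β → MvPowerSeries σ k) ⧸ S) (IsLocalRing.maximalIdeal (MvPowerSeries σ k))
    (Ideal.IsPrime.ne_top inferInstance)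
  have : S.mkQ v ∈ (⊥ : Submodule (MvPowerSeries σ k) ((β → MvPowerSeries σ k) ⧸ S)) := by
    rw [← h0]; exact (Submodule.mem_iInf _).mpr key
  simpa using this

section

open scoped Matrix

/-- A finite free resolution `D 1, D 2, …` of `R ⧸ I` of length `c`, whose dual is exact except at
the last place. The term of homological degree `i` is placed at index `i + 1`, and `D 0` is
the zero map out of `R`. -/
structure MatrixResolution {R : Type*} [CommRing R] (c : ℕ) (I : Ideal R) where
  r : ℕ → ℕ
  D : ∀ i, Matrix (Fin (r i)) (Fin (r (i + 1))) R
  r_zero : r 0 = 0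
  r_one : r 1 = 1
  r_top : r (c + 2) = 0
  comp : ∀ i, D i * D (i + 1) = 0
  exact : ∀ i v, D (i + 1) *ᵥ v = 0 → ∃ u, v = D (i + 2) *ᵥ u
  ideal_eq : I = Ideal.span (Set.range fun x : Fin (r 1) × Fin (r 2) => D 1 x.1 x.2)
  dual_exact : ∀ i < c, ∀ x, x ᵥ* D (i + 1) = 0 → ∃ y, x = y ᵥ* D i

namespace MatrixResolution

variable {R : Type*} [CommRing R] {c : ℕ} {I J : Ideal R}

theorem exact_matrix (P : MatrixResolution c I) {m : Type*} (i : ℕ)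
    (X : Matrix (Fin (P.r (i + 2))) m R) (hX : P.D (i + 1) * X = 0) :
    ∃ Y : Matrix (Fin (P.r (i + 3))) m R, X = P.D (i + 2) * Y := by
  choose u hu using fun j : m => P.exact i (fun k => X k j) (by
    ext a; exact congrFun (congrFun hX a) j)
  refine ⟨Matrix.of fun k j => u j k, ?_⟩
  ext a j
  exact congrFun (hu j) a

theorem dual_exact_matrix (P : MatrixResolution c I) {m : Type*} (i : ℕ) (hi : i < c)
    (X : Matrix m (Fin (P.r (i + 1))) R) (hX : X * P.D (i + 1) = 0) :
    ∃ Y : Matrix m (Fin (P.r i)) R, X = Y * P.D i := by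
  choose u hu using fun j : m => P.dual_exact i hi (X j) (by
    ext a; exact congrFun (congrFun hX j) a)
  refine ⟨Matrix.of u, ?_⟩
  ext j a
  exact congrFun (hu j) a

theorem mem_ideal_iff (P : MatrixResolution c I) (x : R) :
    x ∈ I ↔ ∃ v, ∀ j, (P.D 1 *ᵥ v) j = x := by
  have h1 : Subsingleton (Fin (P.r 1)) := by rw [P.r_one]; infer_instance
  have h2 : Nonempty (Fin (P.r 1)) := by rw [P.r_one]; infer_instance
  obtain ⟨j₀⟩ := h2
  constructor
  · intro hx
    rw [P.ideal_eq] at hx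
    induction hx using Submodule.span_induction with
    | mem x hx =>
      obtain ⟨⟨a, b⟩, rfl⟩ := hx
      refine ⟨Pi.single b 1, fun j => ?_⟩
      rw [Subsingleton.elim j a]
      simp
    | zero => exact ⟨0, by simp⟩
    | add x y _ _ hx hy =>
      obtain ⟨v, hv⟩ := hx
      obtain ⟨w, hw⟩ := hy
      exact ⟨v + w, fun j => by rw [Matrix.mulVec_add, Pi.add_apply, hv, hw]⟩
    | smul a x _ hx =>
      obtain ⟨v, hv⟩ := hx
      exact ⟨a • v, fun j => by rw [Matrix.mulVec_smul, Pi.smul_apply, hv]⟩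
  · rintro ⟨v, hv⟩
    rw [← hv j₀]
    have h := P.ideal_eq.ge
    change ∑ b, P.D 1 j₀ b * v b ∈ I
    exact sum_mem fun b _ => Ideal.mul_mem_right _ _ (h (Ideal.subset_span ⟨(j₀, b), rfl⟩))

theorem exists_chain_map (P : MatrixResolution c I) (Q : MatrixResolution c J) (hIJ : I ≤ J) :
    ∃ g : ∀ i, Matrix (Fin (Q.r i)) (Fin (P.r i)) R,
      (∀ i, g i * P.D i = Q.D i * g (i + 1)) ∧ g 1 = Matrix.of fun _ _ => 1 := by
  have hP : Subsingleton (Fin (P.r 1)) := by rw [P.r_one]; infer_instance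
  have hP' : Nonempty (Fin (P.r 1)) := by rw [P.r_one]; infer_instance
  obtain ⟨j₀⟩ := hP'
  have hQ : IsEmpty (Fin (Q.r 0)) := by rw [Q.r_zero]; infer_instance
  have h0 : ∃ X : Matrix (Fin (Q.r 2)) (Fin (P.r 2)) R,
      (Matrix.of fun _ _ => 1 : Matrix (Fin (Q.r 1)) (Fin (P.r 1)) R) * P.D 1 =
      Q.D 1 * X := by
    choose u hu using fun b => (Q.mem_ideal_iff (P.D 1 j₀ b)).mp (hIJ
      (P.ideal_eq.ge (Ideal.subset_span ⟨(j₀, b), rfl⟩)))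
    refine ⟨Matrix.of fun a b => u b a, ?_⟩
    ext a b
    refine Eq.trans ?_ (hu b a).symm
    rw [Matrix.mul_apply, Fintype.sum_subsingleton _ j₀, Matrix.of_apply, one_mul]
  obtain ⟨X₀, hX₀⟩ := h0
  have step : ∀ i (x : {x : Matrix (Fin (Q.r (i + 1))) (Fin (P.r (i + 1))) R ×
      Matrix (Fin (Q.r (i + 2))) (Fin (P.r (i + 2))) R //
      x.1 * P.D (i + 1) = Q.D (i + 1) * x.2}), ∃ Y : Matrix (Fin (Q.r (i + 3))) (Fin (P.r (i + 3))) R,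
      x.1.2 * P.D (i + 2) = Q.D (i + 2) * Y := by
    rintro i ⟨⟨x, y⟩, h⟩
    refine Q.exact_matrix i _ ?_
    rw [← Matrix.mul_assoc, ← h, Matrix.mul_assoc, P.comp, Matrix.mul_zero]
  choose Y hY using step
  let F : ∀ i, {x : Matrix (Fin (Q.r (i + 1))) (Fin (P.r (i + 1))) R ×
      Matrix (Fin (Q.r (i + 2))) (Fin (P.r (i + 2))) R //
      x.1 * P.D (i + 1) = Q.D (i + 1) * x.2} := fun i =>
    Nat.rec ⟨(Matrix.of fun _ _ => 1, X₀), hX₀⟩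
      (fun i x => ⟨(x.1.2, Y i x), hY i x⟩) i
  refine ⟨fun i => match i with | 0 => 0 | i + 1 => (F i).1.1, fun i => ?_, rfl⟩
  cases i with
  | zero => exact Matrix.ext fun a => isEmptyElim a
  | succ i => exact (F i).2

theorem exists_extend_chain_map (P : MatrixResolution c I) (Q : MatrixResolution c J)
    (g₀ : Matrix (Fin (Q.r c)) (Fin (P.r c)) R)
    (G : Matrix (Fin (Q.r (c + 1))) (Fin (P.r (c + 1))) R) (h : g₀ * P.D c = Q.D c * G) :
    ∃ g : ∀ i, Matrix (Fin (Q.r i)) (Fin (P.r i)) R,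
      (∀ i ≤ c, g i * P.D i = Q.D i * g (i + 1)) ∧ g (c + 1) = G := by
  have key : ∀ m ≤ c, ∃ g : ∀ i, Matrix (Fin (Q.r i)) (Fin (P.r i)) R,
      (∀ i ≤ c, m ≤ i → g i * P.D i = Q.D i * g (i + 1)) ∧ g (c + 1) = G := by
    intro m hm
    induction hm using Nat.decreasingInduction with
    | self =>
      refine ⟨Function.update (Function.update 0 (c + 1) G) c g₀, fun i hi hi' => ?_, ?_⟩
      · obtain rfl := le_antisymm hi hi'
        simpa [Function.update_of_ne] using h
      · simp [Function.update_of_ne]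
    | of_succ m hm ih =>
      obtain ⟨g, hg, rfl⟩ := ih
      obtain ⟨Y, hY⟩ := P.dual_exact_matrix m hm (Q.D m * g (m + 1)) (by
        rw [Matrix.mul_assoc, hg (m + 1) hm le_rfl, ← Matrix.mul_assoc, Q.comp, Matrix.zero_mul])
      refine ⟨Function.update g m Y, fun i hi hi' => ?_, ?_⟩
      · rcases hi'.eq_or_lt with rfl | hlt
        · simp [Function.update_of_ne, hY]
        · rw [Function.update_of_ne hlt.ne', Function.update_of_ne (by omega)]
          exact hg i hi hlt
      · rw [Function.update_of_ne (by omega)]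
  obtain ⟨g, hg, h'⟩ := key 0 c.zero_le
  exact ⟨g, fun i hi => hg i hi i.zero_le, h'⟩

theorem exists_homotopy (P : MatrixResolution c I) (Q : MatrixResolution c J)
    (g : ∀ i, Matrix (Fin (Q.r i)) (Fin (P.r i)) R)
    (hg : ∀ i ≤ c, g i * P.D i = Q.D i * g (i + 1)) (hg1 : g 1 = 0) :
    ∃ h : Matrix (Fin (Q.r (c + 1))) (Fin (P.r c)) R, g (c + 1) = h * P.D c := by
  have key : ∀ i ≤ c, ∃ (h : Matrix (Fin (Q.r (i + 2))) (Fin (P.r (i + 1))) R)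
      (h' : Matrix (Fin (Q.r (i + 1))) (Fin (P.r i)) R),
      g (i + 1) = Q.D (i + 1) * h + h' * P.D i := by
    intro i hi
    induction i with
    | zero => exact ⟨0, 0, by simp [hg1]⟩
    | succ i ih =>
      obtain ⟨h, h', e⟩ := ih (by omega)
      obtain ⟨Y, hY⟩ := Q.exact_matrix i (g (i + 2) - h * P.D (i + 1)) (by
        rw [Matrix.mul_sub, ← hg (i + 1) hi, e, Matrix.add_mul, Matrix.mul_assoc h', P.comp,
          Matrix.mul_zero, add_zero, Matrix.mul_assoc, sub_self])
      exact ⟨Y, h, by rw [← hY, sub_add_cancel]⟩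
  obtain ⟨h, h', e⟩ := key c le_rfl
  have : IsEmpty (Fin (Q.r (c + 2))) := by rw [Q.r_top]; infer_instance
  refine ⟨h', ?_⟩
  rw [e, add_eq_right]
  ext a b
  simp [Matrix.mul_apply]

theorem exists_eq_smul_add (P : MatrixResolution c I) (Q : MatrixResolution c J)
    (π : ∀ i, Matrix (Fin (Q.r i)) (Fin (P.r i)) R)
    (hπ : ∀ i, π i * P.D i = Q.D i * π (i + 1)) (hπ1 : π 1 = Matrix.of fun _ _ => 1)
    (g₀ : Matrix (Fin (Q.r c)) (Fin (P.r c)) R)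
    (G : Matrix (Fin (Q.r (c + 1))) (Fin (P.r (c + 1))) R) (h : g₀ * P.D c = Q.D c * G) :
    ∃ (a : R) (h : Matrix (Fin (Q.r (c + 1))) (Fin (P.r c)) R), G = a • π (c + 1) + h * P.D c := by
  have hP : Subsingleton (Fin (P.r 1)) := by rw [P.r_one]; infer_instance
  have hP' : Nonempty (Fin (P.r 1)) := by rw [P.r_one]; infer_instance
  have hQ : Subsingleton (Fin (Q.r 1)) := by rw [Q.r_one]; infer_instance
  have hQ' : Nonempty (Fin (Q.r 1)) := by rw [Q.r_one]; infer_instance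
  obtain ⟨i₀⟩ := hP'
  obtain ⟨j₀⟩ := hQ'
  obtain ⟨g, hg, rfl⟩ := exists_extend_chain_map P Q g₀ G h
  obtain ⟨h', hh'⟩ := exists_homotopy P Q (fun i => g i - g 1 j₀ i₀ • π i) (fun i hi => by
    rw [Matrix.sub_mul, Matrix.mul_sub, hg i hi, Matrix.smul_mul, Matrix.mul_smul, hπ]) (by
    ext a b
    rw [Subsingleton.elim a j₀, Subsingleton.elim b i₀]
    simp [hπ1])
  exact ⟨g 1 j₀ i₀, h', by rw [← hh', add_sub_cancel]⟩

theorem mem_of_smul_one_eq (P : MatrixResolution c I) (x : R)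
    (h : Matrix (Fin (P.r (c + 1))) (Fin (P.r c)) R)
    (hx : x • (1 : Matrix (Fin (P.r (c + 1))) (Fin (P.r (c + 1))) R) = h * P.D c) : x ∈ I := by
  have key : ∀ m ≤ c, ∃ (h : Matrix (Fin (P.r (m + 2))) (Fin (P.r (m + 1))) R)
      (h' : Matrix (Fin (P.r (m + 1))) (Fin (P.r m)) R),
      x • (1 : Matrix (Fin (P.r (m + 1))) (Fin (P.r (m + 1))) R) =
      P.D (m + 1) * h + h' * P.D m := by
    intro m hm
    induction hm using Nat.decreasingInduction with
    | self => exact ⟨0, h, by rw [hx, Matrix.mul_zero, zero_add]⟩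
    | of_succ m hm ih =>
      obtain ⟨h, h', e⟩ := ih
      obtain ⟨Y, hY⟩ := P.dual_exact_matrix m hm
        (x • (1 : Matrix (Fin (P.r (m + 1))) (Fin (P.r (m + 1))) R) - P.D (m + 1) * h') (by
          have e' := congrArg (P.D (m + 1) * ·) e
          simp only [Matrix.mul_smul, Matrix.mul_one, Matrix.mul_add, ← Matrix.mul_assoc, P.comp,
            Matrix.zero_mul, zero_add] at e'
          rw [Matrix.sub_mul, Matrix.smul_mul, Matrix.one_mul, e', sub_self])
      exact ⟨h', Y, by rw [← hY, add_sub_cancel]⟩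
  obtain ⟨h, h', e⟩ := key 0 c.zero_le
  have : IsEmpty (Fin (P.r 0)) := by rw [P.r_zero]; infer_instance
  have hP : Subsingleton (Fin (P.r 1)) := by rw [P.r_one]; infer_instance
  have hP' : Nonempty (Fin (P.r 1)) := by rw [P.r_one]; infer_instance
  obtain ⟨i₀⟩ := hP'
  refine (P.mem_ideal_iff x).mpr ⟨fun a => h a i₀, fun j => ?_⟩
  have e' := congrFun (congrFun e j) i₀
  rw [Subsingleton.elim j i₀] at e' ⊢
  simpa [Matrix.mul_apply, Matrix.mulVec, dotProduct, eq_comm] using e'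

end MatrixResolution

/-- Flatness of the Frobenius endomorphism, in equational form: the solutions of a linear system
whose coefficients are `p`-th powers are generated by `p`-th powers of solutions. -/
def FrobeniusFlat (R : Type) [CommRing R] (p : ℕ) [ExpChar R p] : Prop :=
  ∀ {α β : Type} [Fintype β] (U : Matrix α β R) (v : β → R), U.map (frobenius R p) *ᵥ v = 0 →
    v ∈ Submodule.span R {w : β → R | ∃ s, U *ᵥ s = 0 ∧ w = frobenius R p ∘ s}

theorem frobPow_eq_map {R : Type} [CommRing R] (p : ℕ) [ExpChar R p] (I : Ideal R) :
    frobPow p I = I.map (frobenius R p) := rfl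

theorem pow_mem_frobPow {R : Type} [CommRing R] (p : ℕ) {I : Ideal R} {x : R} (hx : x ∈ I) :
    x ^ p ∈ frobPow p I := Ideal.subset_span ⟨x, hx, rfl⟩

theorem frobPow_mono {R : Type} [CommRing R] (p : ℕ) {I J : Ideal R} (h : I ≤ J) :
    frobPow p I ≤ frobPow p J := Ideal.span_mono (Set.image_mono h)

theorem frobPow_le {R : Type} [CommRing R] {p : ℕ} (hp : p ≠ 0) (I : Ideal R) :
    frobPow p I ≤ I := by
  rw [frobPow, Ideal.span_le]
  rintro _ ⟨x, hx, rfl⟩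
  exact Ideal.pow_mem_of_mem _ hx _ (Nat.pos_of_ne_zero hp)

namespace FrobeniusFlat

variable {R : Type} [CommRing R] {p : ℕ} [ExpChar R p]

theorem exact (hR : FrobeniusFlat R p) {α β γ : Type} [Fintype β] [Fintype γ]
    (U : Matrix α β R) (V : Matrix β γ R) (h : ∀ s, U *ᵥ s = 0 → ∃ u, s = V *ᵥ u) (v : β → R)
    (hv : U.map (frobenius R p) *ᵥ v = 0) : ∃ u, v = V.map (frobenius R p) *ᵥ u := by
  have h1 : v ∈ LinearMap.range (V.map (frobenius R p)).mulVecLin := by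
    refine Submodule.span_le.mpr ?_ (hR U v hv)
    rintro _ ⟨s, hs, rfl⟩
    obtain ⟨u, rfl⟩ := h s hs
    exact ⟨frobenius R p ∘ u, by ext; simp [RingHom.map_mulVec]⟩
  obtain ⟨u, hu⟩ := h1
  exact ⟨u, hu.symm⟩

theorem mem_span_of_dotProduct_mem (hR : FrobeniusFlat R p) {I : Ideal R} (hI : I.FG)
    {β : Type} [Fintype β] (w v : β → R)
    (hv : v ⬝ᵥ (frobenius R p ∘ w) ∈ frobPow p I) :
    v ∈ Submodule.span R {x : β → R | ∃ s, s ⬝ᵥ w ∈ I ∧ x = frobenius R p ∘ s} := by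
  obtain ⟨l, b, rfl⟩ := Submodule.fg_iff_exists_fin_generating_family.mp hI
  change _ ∈ frobPow p (Ideal.span _) at hv
  rw [frobPow_eq_map, Ideal.map_span, ← Set.range_comp] at hv
  obtain ⟨z, hz⟩ := (Submodule.mem_span_range_iff_exists_fun R).mp hv
  have h1 := hR (Matrix.of fun (_ : Unit) => Sum.elim w b) (Sum.elim v (-z)) (by
    ext
    simpa [Matrix.mulVec, dotProduct, ← sub_eq_add_neg, mul_comm, sub_eq_zero] using hz.symm)
  have h2 := Submodule.mem_map_of_mem (f := LinearMap.funLeft R R (Sum.inl : β → β ⊕ Fin l)) h1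
  rw [Submodule.map_span] at h2
  refine Submodule.span_mono ?_ h2
  rintro _ ⟨_, ⟨s, hs, rfl⟩, rfl⟩
  refine ⟨s ∘ Sum.inl, ?_, rfl⟩
  have h3 := congrFun hs ()
  simp only [Matrix.mulVec, dotProduct, Matrix.of_apply, Fintype.sum_sum_type, Sum.elim_inl,
    Sum.elim_inr, Pi.zero_apply] at h3
  have h4 : (s ∘ Sum.inl) ⬝ᵥ w = - ∑ x, b x * s (Sum.inr x) := by
    rw [← add_eq_zero_iff_eq_neg, ← h3]
    simp [dotProduct, mul_comm]
  rw [h4]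
  exact neg_mem (sum_mem fun i _ => Ideal.mul_mem_right _ _ (Ideal.subset_span ⟨i, rfl⟩))

theorem mem_of_mul_mem (hR : FrobeniusFlat R p) {I : Ideal R} (hI : I.FG) {f : R}
    (hf : ∀ x, x * f ∈ I → x ∈ I) {x : R} (hx : x * f ∈ frobPow p I) : x ∈ frobPow p I := by
  have hp : p ≠ 0 := (expChar_pos R p).ne'
  have h1 := hR.mem_span_of_dotProduct_mem hI (fun _ : Unit => f) (fun _ => x) (by
    obtain ⟨m, rfl⟩ := Nat.exists_eq_succ_of_ne_zero hp
    simp only [dotProduct, Finset.univ_unique, Finset.sum_singleton, Function.comp, frobenius_def]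
    rw [pow_succ', ← mul_assoc]
    exact Ideal.mul_mem_right _ _ hx)
  have h2 := Submodule.mem_map_of_mem (f := (LinearMap.proj () : (Unit → R) →ₗ[R] R)) h1
  rw [Submodule.map_span] at h2
  refine Submodule.span_le.mpr ?_ h2
  rintro _ ⟨_, ⟨s, hs, rfl⟩, rfl⟩
  exact pow_mem_frobPow p (hf _ (by simpa [dotProduct] using hs))

end FrobeniusFlat

/-- The pullback of a resolution along the Frobenius endomorphism. -/
noncomputable abbrev MatrixResolution.frobenius {R : Type} [CommRing R] {p : ℕ} [ExpChar R p]
    (hR : FrobeniusFlat R p) {c : ℕ} {I : Ideal R} (P : MatrixResolution c I) :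
    MatrixResolution c (frobPow p I) where
  r := P.r
  D i := (P.D i).map (_root_.frobenius R p)
  r_zero := P.r_zero
  r_one := P.r_one
  r_top := P.r_top
  comp i := by rw [← Matrix.map_mul, P.comp, Matrix.map_zero _ (map_zero _)]
  exact i v hv := hR.exact _ _ (P.exact i) v hv
  ideal_eq := by
    conv_lhs => rw [P.ideal_eq]
    rw [frobPow_eq_map, Ideal.map_span, ← Set.range_comp]
    rfl
  dual_exact i hi x hx := by
    have h := hR.exact (P.D (i + 1))ᵀ (P.D i)ᵀ (by
      simpa only [Matrix.mulVec_transpose] using P.dual_exact i hi) x (by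
        rwa [Matrix.transpose_map, Matrix.mulVec_transpose])
    simpa only [Matrix.transpose_map, Matrix.mulVec_transpose] using h

namespace MatrixResolution

variable {R : Type} [CommRing R] {p : ℕ} [ExpChar R p] {c : ℕ} {I : Ideal R}

theorem exists_vecMul_frobenius (hR : FrobeniusFlat R p) (hI : I.FG) (P : MatrixResolution c I)
    (w : Fin (P.r (c + 1)) → R) (hw : ∀ v, v ⬝ᵥ w ∈ I → ∃ y, v = y ᵥ* P.D c)
    (v : Fin (P.r (c + 1)) → R) (hv : v ⬝ᵥ (_root_.frobenius R p ∘ w) ∈ frobPow p I) :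
    ∃ y, v = y ᵥ* (P.frobenius hR).D c := by
  have h1 : v ∈ LinearMap.range ((P.frobenius hR).D c).vecMulLinear := by
    refine Submodule.span_le.mpr ?_ (hR.mem_span_of_dotProduct_mem hI w v hv)
    rintro _ ⟨s, hs, rfl⟩
    obtain ⟨u, rfl⟩ := hw s hs
    exact ⟨_root_.frobenius R p ∘ u, by ext; simp [RingHom.map_vecMul]⟩
  obtain ⟨y, hy⟩ := h1
  exact ⟨y, hy.symm⟩

theorem exists_matrix_mul_frobenius (hR : FrobeniusFlat R p) (hI : I.FG)
    (P : MatrixResolution c I)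
    (w : Fin (P.r (c + 1)) → R) (hw : ∀ v, v ⬝ᵥ w ∈ I → ∃ y, v = y ᵥ* P.D c) {m : Type*}
    (X : Matrix m (Fin (P.r (c + 1))) R)
    (hX : ∀ a, (X *ᵥ (_root_.frobenius R p ∘ w)) a ∈ frobPow p I) :
    ∃ Y : Matrix m (Fin (P.r c)) R, Y * (P.frobenius hR).D c = X := by
  choose y hy using fun a => P.exists_vecMul_frobenius hR hI w hw (X a) (hX a)
  refine ⟨Matrix.of y, ?_⟩
  ext a b
  exact (congrFun (hy a) b).symm

theorem mulVec_frobenius_mem (hR : FrobeniusFlat R p) (P : MatrixResolution c I)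
    (w : Fin (P.r (c + 1)) → R) (hw : ∀ a, (P.D c *ᵥ w) a ∈ I) (a : Fin (P.r c)) :
    ((P.frobenius hR).D c *ᵥ (_root_.frobenius R p ∘ w)) a ∈ frobPow p I := by
  have : ((P.frobenius hR).D c *ᵥ (_root_.frobenius R p ∘ w)) a =
      _root_.frobenius R p ((P.D c *ᵥ w) a) := by rw [RingHom.map_mulVec]
  rw [this]
  exact pow_mem_frobPow p (hw a)

theorem mulVec_mem {R : Type} [CommRing R] {m n : Type*} [Fintype n] (X : Matrix m n R) (v : n → R)
    {J : Ideal R} (hv : ∀ b, v b ∈ J) (a : m) : (X *ᵥ v) a ∈ J :=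
  sum_mem fun b _ => Ideal.mul_mem_left _ _ (hv b)

theorem dotProduct_mem {R : Type} [CommRing R] {n : Type*} [Fintype n] (v w : n → R)
    {J : Ideal R} (hw : ∀ b, w b ∈ J) : v ⬝ᵥ w ∈ J :=
  sum_mem fun b _ => Ideal.mul_mem_left _ _ (hw b)

/-- Cyclicity, for an ideal `Ω = I + (w)` presented by the transpose of the last
differential of a self-dual-type resolution of `R ⧸ I`. -/
theorem exists_colon_inf_colon_eq (hR : FrobeniusFlat R p) (hI : I.FG) (P : MatrixResolution c I)
    (w : Fin (P.r (c + 1)) → R) (hw : ∀ v, v ⬝ᵥ w ∈ I ↔ ∃ y, v = y ᵥ* P.D c)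
    {Ω : Ideal R} (hΩ : Ω = I ⊔ Ideal.span (Set.range w))
    {f : R} (hf : f ∈ Ω) (hfI : ∀ x, x * f ∈ I → x ∈ I) :
    ∃ u : R, Submodule.colon (frobPow p I) I ⊓ Submodule.colon (frobPow p Ω) Ω =
        frobPow p I ⊔ Ideal.span {u} := by
  have hp0 : p ≠ 0 := (expChar_pos R p).ne'
  have hI' : frobPow p I ≤ I := frobPow_le hp0 I
  have hIΩ : I ≤ Ω := hΩ ▸ le_sup_left
  have hwΩ : ∀ j, w j ∈ Ω := fun j => by
    rw [hΩ]; exact Ideal.mem_sup_right (Ideal.subset_span ⟨j, rfl⟩)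
  have hΩ' : frobPow p Ω = frobPow p I ⊔ Ideal.span (Set.range (_root_.frobenius R p ∘ w)) := by
    rw [hΩ, frobPow_eq_map, Ideal.map_sup, Ideal.map_span, ← Set.range_comp]; rfl
  set F := P.frobenius hR with hF
  set wp := _root_.frobenius R p ∘ w with hwp
  let q := Ideal.Quotient.mk (frobPow p I)
  have hq : ∀ x, q x = 0 ↔ x ∈ frobPow p I := fun x => Ideal.Quotient.eq_zero_iff_mem
  have hqf : ∀ x, q x * q f = 0 → q x = 0 := fun x hx => by
    rw [← map_mul, hq] at hx
    exact (hq x).mpr (hR.mem_of_mul_mem hI hfI hx)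
  have hDw : ∀ a, (P.D c *ᵥ w) a ∈ I := fun a =>
    (hw (P.D c a)).mpr ⟨Pi.single a 1, by simp [Matrix.row]⟩
  have hqm : ∀ {m : ℕ} (X : Matrix (Fin m) (Fin (P.r (c + 1))) R) v a,
      q ((X *ᵥ v) a) = ∑ i, q (X a i) * q (v i) := fun X v a => by
    simp [Matrix.mulVec, dotProduct]
  obtain ⟨π, hπ, hπ1⟩ := exists_chain_map F P hI'
  set t := π (c + 1) *ᵥ wp with ht
  have htI : ∀ v, v ⬝ᵥ w ∈ I → v ⬝ᵥ t ∈ frobPow p I := by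
    intro v hv
    obtain ⟨y, rfl⟩ := (hw v).mp hv
    rw [← Matrix.dotProduct_mulVec, ht, Matrix.mulVec_mulVec, ← hπ, ← Matrix.mulVec_mulVec]
    exact dotProduct_mem _ _ (mulVec_mem _ _ (P.mulVec_frobenius_mem hR w hDw))
  have hIt : ∀ i ∈ I, ∀ j, q i * q (t j) = 0 := by
    intro i hi j
    have := htI (Pi.single j i) (by simpa using Ideal.mul_mem_right _ _ hi)
    rwa [single_dotProduct, ← hq, map_mul] at this
  obtain ⟨i₀, hi₀, z, hz, hfz⟩ := Submodule.mem_sup.mp (hΩ ▸ hf)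
  obtain ⟨b, hb⟩ := (Submodule.mem_span_range_iff_exists_fun R).mp hz
  replace hb : b ⬝ᵥ w = z := hb
  set g := b ⬝ᵥ t
  have hft : ∀ j, q f * q (t j) = q (w j) * q g := by
    intro j
    have h1 := htI (Pi.single j z - w j • b) (by
      rw [sub_dotProduct, single_dotProduct, smul_dotProduct, hb, smul_eq_mul, mul_comm, sub_self]
      exact zero_mem _)
    rw [sub_dotProduct, single_dotProduct, smul_dotProduct, ← hq, smul_eq_mul, map_sub, map_mul,
      map_mul] at h1
    have h2 := hIt i₀ hi₀ j
    rw [← hfz, map_add]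
    linear_combination h1 + h2
  let s : Fin (P.r (c + 1)) → R := fun i => w i ^ (p - 1) * t i
  have hfs : ∀ i, q f * q (s i) = q g * q (wp i) := by
    intro i
    have h1 : wp i = w i ^ (p - 1) * w i := (pow_sub_one_mul hp0 (w i)).symm
    rw [h1, map_mul, map_mul]
    linear_combination q (w i ^ (p - 1)) * hft i
  have hDwp : ∀ a, q ((F.D c *ᵥ wp) a) = 0 := fun a =>
    (hq _).mpr (P.mulVec_frobenius_mem hR w hDw a)
  have hDs : ∀ a, (F.D c *ᵥ s) a ∈ frobPow p I := by
    intro a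
    rw [← hq]
    apply hqf
    have h1 := hDwp a
    rw [mul_comm, ← mul_zero (q g), ← h1]
    simp only [Matrix.mulVec, dotProduct, map_sum, map_mul, Finset.mul_sum]
    refine Finset.sum_congr rfl fun i _ => ?_
    linear_combination q (F.D c a i) * hfs i
  let H : Matrix (Fin (P.r (c + 1))) (Fin (P.r (c + 1))) R :=
    Matrix.diagonal (fun i => w i ^ (p - 1)) * π (c + 1)
  have hHs : H *ᵥ wp = s := by
    ext i
    rw [← Matrix.mulVec_mulVec, Matrix.mulVec_diagonal]
  obtain ⟨g₁, hg₁⟩ := P.exists_matrix_mul_frobenius hR hI w (fun v => (hw v).mp)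
    (F.D c * H) (by rw [← Matrix.mulVec_mulVec, hHs]; exact hDs)
  obtain ⟨u, h, hu⟩ := exists_eq_smul_add F F (fun _ => 1) (fun i => by
    rw [Matrix.one_mul, Matrix.mul_one]) (by
      have : Subsingleton (Fin (P.r 1)) := by rw [P.r_one]; infer_instance
      ext a b
      rw [Subsingleton.elim a b]; simp) g₁ H hg₁
  have hus : ∀ i, q (s i) = q u * q (wp i) := by
    intro i
    have h1 := (hq _).mpr (mulVec_mem h _ (P.mulVec_frobenius_mem hR w hDw) i)
    rw [← hHs, hu, Matrix.add_mulVec, Matrix.smul_mulVec, Matrix.one_mulVec,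
      ← Matrix.mulVec_mulVec, Pi.add_apply, map_add, h1, add_zero, Pi.smul_apply, smul_eq_mul,
      map_mul]
  have hugw : ∀ i, (q u * q f - q g) * q (wp i) = 0 := fun i => by
    linear_combination hfs i - q f * hus i
  have hug : q u * q f = q g := by
    have hpow : ∀ m : ℕ, (q u * q f - q g) * q f ^ m = 0 → q u * q f - q g = 0 := by
      intro m hm
      induction m with
      | zero => simpa using hm
      | succ m ih =>
        rw [pow_succ, ← mul_assoc, ← map_mul, ← map_sub, ← map_pow, ← map_mul] at hm
        have := hqf _ hm
        exact ih (by simpa using this)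
    refine sub_eq_zero.mp (hpow p ?_)
    have h1 := (hq _).mpr (pow_mem_frobPow p hi₀)
    have h2 : f ^ p = i₀ ^ p + ∑ j, b j ^ p * wp j := by
      rw [← hfz, ← hb, add_pow_expChar]
      simp [dotProduct, ← frobenius_def, hwp]
    rw [← map_pow, h2, map_add, h1, zero_add, map_sum, Finset.mul_sum]
    refine Finset.sum_eq_zero fun j _ => ?_
    rw [map_mul]
    linear_combination q (b j ^ p) * hugw j
  have hut : ∀ j, q u * q (w j) = q (t j) := fun j => by
    rw [← sub_eq_zero, ← map_mul, ← map_sub]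
    apply hqf
    rw [map_sub, map_mul]
    linear_combination q (w j) * hug - hft j
  have htΩ : ∀ j, t j ∈ frobPow p Ω := mulVec_mem _ _ fun j => pow_mem_frobPow p (hwΩ j)
  have hig : ∀ i ∈ I, q i * q g = 0 := by
    intro i hi
    simp only [g, dotProduct, map_sum, map_mul, Finset.mul_sum]
    exact Finset.sum_eq_zero fun j _ => by linear_combination q (b j) * hIt i hi j
  have huI : ∀ i ∈ I, u * i ∈ frobPow p I := by
    intro i hi
    rw [← hq]
    apply hqf
    rw [map_mul]
    linear_combination q i * hug + hig i hi
  have hI'Ω' : frobPow p I ≤ frobPow p Ω := frobPow_mono p hIΩ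
  refine ⟨u, le_antisymm ?_ (sup_le ?_ ?_)⟩
  · rintro x ⟨hxI, hxΩ⟩
    rw [SetLike.mem_coe, Submodule.mem_colon] at hxI hxΩ
    have h1 : ∀ j, ∃ y, x * w j - y ⬝ᵥ wp ∈ frobPow p I := by
      intro j
      have h2 := hxΩ (w j) (hwΩ j)
      rw [hΩ', smul_eq_mul] at h2
      obtain ⟨i, hi, z, hz, e⟩ := Submodule.mem_sup.mp h2
      obtain ⟨y, rfl⟩ := (Submodule.mem_span_range_iff_exists_fun R).mp hz
      exact ⟨y, by rw [← e]; simpa [dotProduct] using hi⟩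
    choose G hG using h1
    have hG' : ∀ j, q ((Matrix.of G *ᵥ wp) j) = q x * q (w j) := fun j => by
      rw [← map_mul, ← sub_eq_zero, ← map_sub, hq, ← neg_mem_iff, neg_sub]
      exact hG j
    obtain ⟨g₂, hg₂⟩ := P.exists_matrix_mul_frobenius hR hI w (fun v => (hw v).mp)
      (P.D c * Matrix.of G) (fun a => by
        rw [← Matrix.mulVec_mulVec, ← hq]
        have h2 := (hq _).mpr (hxI _ (hDw a))
        rw [← h2]
        rw [smul_eq_mul, map_mul, hqm, hqm, Finset.mul_sum]
        exact Finset.sum_congr rfl fun i _ => by linear_combination q (P.D c a i) * hG' i)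
    obtain ⟨a, h', ha⟩ := exists_eq_smul_add F P π hπ hπ1 g₂ (Matrix.of G) hg₂
    have hxa : ∀ j, q (x - a * u) * q (w j) = 0 := by
      intro j
      have h2 := (hq _).mpr (mulVec_mem h' _ (P.mulVec_frobenius_mem hR w hDw) j)
      have h3 := hG' j
      rw [ha, Matrix.add_mulVec, Matrix.smul_mulVec, ← ht, ← Matrix.mulVec_mulVec, Pi.add_apply,
        map_add, h2, add_zero, Pi.smul_apply, smul_eq_mul, map_mul] at h3
      rw [map_sub, map_mul]
      linear_combination - h3 - q a * hut j
    have hxi : q (x - a * u) * q i₀ = 0 := by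
      rw [← map_mul, hq, sub_mul, mul_assoc]
      exact sub_mem (hxI _ hi₀) (Ideal.mul_mem_left _ _ (huI _ hi₀))
    have hx0 : q (x - a * u) = 0 := by
      apply hqf
      rw [← hfz, map_add, mul_add, hxi, ← hb]
      simp only [dotProduct, map_sum, map_mul, Finset.mul_sum, zero_add]
      exact Finset.sum_eq_zero fun j _ => by linear_combination q (b j) * hxa j
    rw [← sub_add_cancel x (a * u)]
    exact Submodule.add_mem_sup ((hq _).mp hx0)
      (Ideal.mul_mem_left _ _ (Ideal.mem_span_singleton_self u))
  · exact le_inf Ideal.le_colon (hI'Ω'.trans Ideal.le_colon)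
  · rw [Ideal.span_singleton_le_iff_mem]
    refine ⟨Submodule.mem_colon.mpr huI, Submodule.mem_colon.mpr fun y hy => ?_⟩
    obtain ⟨i, hi, z, hz, rfl⟩ := Submodule.mem_sup.mp (hΩ ▸ (show y ∈ Ω from hy))
    obtain ⟨y, rfl⟩ := (Submodule.mem_span_range_iff_exists_fun R).mp hz
    rw [smul_add, Finset.smul_sum]
    refine add_mem (hI'Ω' (huI i hi)) (sum_mem fun j _ => ?_)
    rw [smul_comm]
    refine Submodule.smul_mem _ _ ?_
    rw [← sub_add_cancel (u • w j) (t j)]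
    refine add_mem (hI'Ω' ?_) (htΩ j)
    rw [← hq, map_sub, smul_eq_mul, map_mul, hut, sub_self]

end MatrixResolution

theorem Ideal.exists_mem_forall_mul_mem {R : Type*} [CommRing R] [IsNoetherianRing R]
    {I Ω : Ideal R} (h : ∀ x, (∀ y ∈ Ω, x * y ∈ I) → x ∈ I) :
    ∃ f ∈ Ω, ∀ x, x * f ∈ I → x ∈ I := by
  have hs : Subsingleton ((R ⧸ Ω) →ₗ[R] (R ⧸ I)) := by
    rw [subsingleton_iff_forall_eq 0]
    intro φ
    obtain ⟨x, hx⟩ := Ideal.Quotient.mk_surjective (φ 1)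
    have hxI : x ∈ I := h x fun y hy => by
      rw [← Ideal.Quotient.eq_zero_iff_mem, mul_comm, ← smul_eq_mul]
      change y • Ideal.Quotient.mk I x = 0
      rw [hx, ← map_smul, ← map_zero φ]
      congr 1
      rw [← map_one (Ideal.Quotient.mk Ω)]
      exact Ideal.Quotient.eq_zero_iff_mem.mpr (by simpa using hy)
    ext
    change φ 1 = 0
    rw [← hx]
    exact Ideal.Quotient.eq_zero_iff_mem.mpr hxI
  obtain ⟨f, hf, hreg⟩ := IsSMulRegular.subsingleton_linearMap_iff.mp hs
  rw [Ideal.annihilator_quotient] at hf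
  refine ⟨f, hf, fun x hx => ?_⟩
  rw [← Ideal.Quotient.eq_zero_iff_mem]
  refine hreg ?_
  change f • Ideal.Quotient.mk I x = f • 0
  rw [smul_zero]
  exact Ideal.Quotient.eq_zero_iff_mem.mpr (by simpa [mul_comm] using hx)

theorem MatrixResolution.exists_mem_forall_mul_mem {R : Type*} [CommRing R] [IsNoetherianRing R]
    {c : ℕ} {I Ω : Ideal R} (P : MatrixResolution c I) (w : Fin (P.r (c + 1)) → R)
    (hw : ∀ v, v ⬝ᵥ w ∈ I → ∃ y, v = y ᵥ* P.D c) (hwΩ : ∀ j, w j ∈ Ω) :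
    ∃ f ∈ Ω, ∀ x, x * f ∈ I → x ∈ I := by
  refine Ideal.exists_mem_forall_mul_mem fun x hx => ?_
  choose y hy using fun j => hw (Pi.single j x) (by
    rw [single_dotProduct]; exact hx _ (hwΩ j))
  refine P.mem_of_smul_one_eq x (Matrix.of y) ?_
  ext i j
  rw [Matrix.smul_apply, Matrix.one_apply, smul_ite, smul_zero, smul_eq_mul, mul_one]
  refine Eq.trans ?_ (congrFun (hy i) j)
  rw [Pi.single_apply]
  simp only [eq_comm]

end

section

open scoped Matrix

open CategoryTheory Limits

theorem ModuleCat.exists_projectiveResolution {R : Type} [CommRing R] {Z : ModuleCat.{0} R}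
    (X : ℕ → ModuleCat.{0} R) [∀ i, Projective (X i)] (d : ∀ i, X (i + 1) ⟶ X i) (ε : X 0 ⟶ Z)
    (hd : ∀ i, d (i + 1) ≫ d i = 0) (hε : d 0 ≫ ε = 0)
    (hexact : ∀ i, (ShortComplex.mk _ _ (hd i)).Exact) (hexact₀ : (ShortComplex.mk _ _ hε).Exact)
    (hepi : Epi ε) : ∃ P : ProjectiveResolution Z, P.complex = ChainComplex.of X d hd := by
  have key : ∀ i, (ChainComplex.of X d hd).d (i + 1) i = d i := ChainComplex.of_d X d
  have hε' : (ChainComplex.of X d hd).d 1 0 ≫ ε = 0 := by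
    rw [key 0]; exact hε
  refine ⟨{ complex := ChainComplex.of X d hd
            projective := fun n => by dsimp; infer_instance
            π := (ChainComplex.toSingle₀Equiv _ _).symm ⟨ε, hε'⟩
            quasiIso := ⟨fun n => ?_⟩ }, rfl⟩
  cases n with
  | zero =>
    rw [ChainComplex.quasiIsoAt₀_iff, ShortComplex.quasiIso_iff_of_zeros']
    · refine (ShortComplex.exact_and_epi_g_iff_of_iso ?_).2 ⟨hexact₀, hepi⟩
      refine ShortComplex.isoMk (Iso.refl _) (Iso.refl _) (Iso.refl _) ?_ ?_
      · exact (Category.id_comp _).trans ((key 0).symm.trans (Category.comp_id _).symm)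
      · refine (Category.id_comp _).trans (Eq.trans ?_ (Category.comp_id _).symm)
        exact (ChainComplex.toSingle₀Equiv_symm_apply_f_zero (C := ChainComplex.of X d hd) ε hε').symm
    all_goals rfl
  | succ n =>
    rw [quasiIsoAt_iff_exactAt']
    · rw [HomologicalComplex.exactAt_iff' _ (n + 1 + 1) (n + 1) n (by simp) (by simp)]
      refine (ShortComplex.exact_iff_of_iso ?_).mpr (hexact n)
      refine ShortComplex.isoMk (Iso.refl _) (Iso.refl _) (Iso.refl _) ?_ ?_
      · exact (Category.id_comp _).trans ((key (n + 1)).symm.trans (Category.comp_id _).symm)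
      · exact (Category.id_comp _).trans ((key n).symm.trans (Category.comp_id _).symm)
    · apply ChainComplex.exactAt_succ_single_obj

/-- The cohomology of a cochain complex of modules in a degree followed by zero. -/
theorem CochainComplex.exists_linearMap_homology {R : Type} [CommRing R]
    (K : CochainComplex (ModuleCat.{0} R) ℕ) (c : ℕ) (hK : IsZero (K.X (c + 1))) :
    ∃ Φ : K.X c →ₗ[R] K.homology c, Function.Surjective Φ ∧
      ∀ x, Φ x = 0 ↔ ∃ y, (K.d ((ComplexShape.up ℕ).prev c) c).hom y = x := by
  have h0 : K.d c (c + 1) = 0 := hK.eq_of_tgt _ _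
  have h1 : IsIso (K.iCycles c) := K.isIso_iCycles c (c + 1) (by simp) h0
  have hex : (ShortComplex.mk _ _ (K.toCycles_comp_homologyπ ((ComplexShape.up ℕ).prev c) c)).Exact :=
    ShortComplex.exact_of_g_is_cokernel _ (K.homologyIsCokernel _ c rfl)
  rw [ShortComplex.moduleCat_exact_iff] at hex
  have hi : ∀ x, (K.iCycles c).hom ((inv (K.iCycles c)).hom x) = x := fun x => by
    rw [← ModuleCat.comp_apply, IsIso.inv_hom_id]; rfl
  have hi' : ∀ x, (inv (K.iCycles c)).hom ((K.iCycles c).hom x) = x := fun x => by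
    rw [← ModuleCat.comp_apply, IsIso.hom_inv_id]; rfl
  have ht : ∀ y, (K.iCycles c).hom ((K.toCycles ((ComplexShape.up ℕ).prev c) c).hom y) =
      (K.d ((ComplexShape.up ℕ).prev c) c).hom y := fun y => by
    rw [← ModuleCat.comp_apply, K.toCycles_i]
  refine ⟨(inv (K.iCycles c) ≫ K.homologyπ c).hom, ?_, fun x => ⟨fun hx => ?_, ?_⟩⟩
  · rw [← ModuleCat.epi_iff_surjective]
    infer_instance
  · obtain ⟨y, hy⟩ := hex _ hx
    exact ⟨y, by rw [← ht, ← hi x]; exact congrArg (K.iCycles c).hom hy⟩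
  · rintro ⟨y, rfl⟩
    change (K.homologyπ c).hom ((inv (K.iCycles c)).hom _) = 0
    rw [← ht, hi', ← ModuleCat.comp_apply, K.toCycles_comp_homologyπ]
    rfl

namespace MatrixResolution

variable {R : Type} [CommRing R] {c : ℕ} {I : Ideal R}

/-- The differentials of a matrix resolution as morphisms of modules. -/
noncomputable abbrev dHom (P : MatrixResolution c I) (i : ℕ) :
    ModuleCat.of R (Fin (P.r (i + 2)) → R) ⟶ ModuleCat.of R (Fin (P.r (i + 1)) → R) :=
  ModuleCat.ofHom (P.D (i + 1)).mulVecLin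

theorem dHom_comp (P : MatrixResolution c I) (i : ℕ) : P.dHom (i + 1) ≫ P.dHom i = 0 := by
  rw [dHom, dHom, ← ModuleCat.ofHom_comp, ← Matrix.mulVecLin_mul, P.comp, Matrix.mulVecLin_zero]
  rfl

theorem exists_projectiveResolution (P : MatrixResolution c I) :
    ∃ Q : ProjectiveResolution (ModuleCat.of R (R ⧸ I)),
      Q.complex = ChainComplex.of (fun i => ModuleCat.of R (Fin (P.r (i + 1)) → R)) P.dHom
        P.dHom_comp := by
  have h1 : Subsingleton (Fin (P.r 1)) := by rw [P.r_one]; infer_instance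
  have h2 : Nonempty (Fin (P.r 1)) := by rw [P.r_one]; infer_instance
  obtain ⟨j₀⟩ := h2
  have hmk : ∀ x : R, (Submodule.mkQ I) x = 0 ↔ x ∈ I :=
    fun x => Ideal.Quotient.eq_zero_iff_mem
  refine ModuleCat.exists_projectiveResolution _ _
    (ModuleCat.ofHom ((Submodule.mkQ I).comp (LinearMap.proj j₀))) _ ?_ (fun i => ?_) ?_ ?_
  · refine ModuleCat.hom_ext (LinearMap.ext fun x => ?_)
    change Submodule.mkQ I ((P.D 1 *ᵥ x) j₀) = 0
    rw [hmk, P.mem_ideal_iff]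
    exact ⟨x, fun j => by rw [Subsingleton.elim j j₀]⟩
  · rw [ShortComplex.moduleCat_exact_iff]
    intro v hv
    obtain ⟨u, rfl⟩ := P.exact i v hv
    exact ⟨u, rfl⟩
  · rw [ShortComplex.moduleCat_exact_iff]
    intro (v : Fin (P.r 1) → R) hv
    obtain ⟨u, hu⟩ := (P.mem_ideal_iff _).mp ((hmk (v j₀)).mp hv)
    refine ⟨u, ?_⟩
    ext j
    exact (hu j).trans (by rw [Subsingleton.elim j j₀])
  · rw [ModuleCat.epi_iff_surjective]
    intro y
    obtain ⟨x, rfl⟩ := Submodule.mkQ_surjective I y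
    exact ⟨fun _ => x, rfl⟩

/-- A row vector as a morphism from a free module to the ring. -/
noncomputable def rowEquiv (R : Type) [CommRing R] (m : ℕ) :
    (Fin m → R) ≃ₗ[R] (ModuleCat.of R (Fin m → R) ⟶ ModuleCat.of R R) :=
  (Module.piEquiv (Fin m) R R).trans
    (ModuleCat.homLinearEquiv (S := R) (M := ModuleCat.of R (Fin m → R))
      (N := ModuleCat.of R R)).symm

theorem rowEquiv_hom_apply {m : ℕ} (v w : Fin m → R) : (rowEquiv R m v).hom w = w ⬝ᵥ v := by
  change Module.piEquiv (Fin m) R R v w = _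
  rw [Module.piEquiv_apply_apply]
  rfl

theorem dHom_comp_rowEquiv (P : MatrixResolution c I) (i : ℕ) (y : Fin (P.r (i + 1)) → R) :
    P.dHom i ≫ rowEquiv R _ y = rowEquiv R _ (y ᵥ* P.D (i + 1)) := by
  refine ModuleCat.hom_ext (LinearMap.ext fun x => ?_)
  change (rowEquiv R _ y).hom (P.D (i + 1) *ᵥ x) = _
  rw [rowEquiv_hom_apply, rowEquiv_hom_apply, dotProduct_comm, Matrix.dotProduct_mulVec,
    dotProduct_comm]

theorem exists_linearMap_extModule (P : MatrixResolution c I) :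
    ∃ Φ : (Fin (P.r (c + 1)) → R) →ₗ[R] extModule R c (R ⧸ I) R, Function.Surjective Φ ∧
      ∀ v, Φ v = 0 ↔ ∃ y, v = y ᵥ* P.D c := by
  obtain ⟨Q, hQ⟩ := P.exists_projectiveResolution
  let iso := Q.isoExt (R := R) c (ModuleCat.of R R)
  rw [hQ] at iso
  set C := ChainComplex.of (fun i => ModuleCat.of R (Fin (P.r (i + 1)) → R)) P.dHom
        P.dHom_comp with hC
  let K := C.linearYonedaObj R (ModuleCat.of R R)
  let e : ∀ i, (Fin (P.r (i + 1)) → R) ≃ₗ[R] K.X i := fun i => rowEquiv R (P.r (i + 1))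
  have hKd : ∀ i y, (K.d i (i + 1)).hom (e i y) = e (i + 1) (y ᵥ* P.D (i + 1)) := by
    intro i y
    rw [← show P.dHom i ≫ rowEquiv R _ y = e (i + 1) (y ᵥ* P.D (i + 1)) from
      P.dHom_comp_rowEquiv i y]
    change C.d (i + 1) i ≫ rowEquiv R _ y = _
    exact congrArg (fun f => f ≫ rowEquiv R _ y)
      (ChainComplex.of_d (fun i => ModuleCat.of R (Fin (P.r (i + 1)) → R)) P.dHom i)
  have hK : IsZero (K.X (c + 1)) := by
    have : IsEmpty (Fin (P.r (c + 2))) := by rw [P.r_top]; infer_instance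
    have : Subsingleton (K.X (c + 1)) := (e (c + 1)).symm.injective.subsingleton
    exact ModuleCat.isZero_of_subsingleton _
  obtain ⟨Φ, hΦ, hΦ'⟩ := K.exists_linearMap_homology c hK
  refine ⟨iso.toLinearEquiv.symm.toLinearMap ∘ₗ Φ ∘ₗ (e c).toLinearMap, ?_, fun v => ?_⟩
  · exact iso.toLinearEquiv.symm.surjective.comp (hΦ.comp (e c).surjective)
  · change iso.toLinearEquiv.symm (Φ (e c v)) = 0 ↔ _
    rw [LinearEquiv.map_eq_zero_iff, hΦ']
    cases c with
    | zero =>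
      have : IsEmpty (Fin (P.r 0)) := by rw [P.r_zero]; infer_instance
      have hd : ∀ j, K.d j 0 = 0 := fun j => K.shape _ _ (by simp)
      rw [hd]
      constructor
      · rintro ⟨y, hy⟩
        refine ⟨0, ?_⟩
        rw [Matrix.zero_vecMul]
        exact ((e 0).map_eq_zero_iff).mp hy.symm
      · rintro ⟨y, rfl⟩
        refine ⟨0, ?_⟩
        rw [Subsingleton.elim y 0, Matrix.zero_vecMul, map_zero, map_zero]
    | succ m =>
      have hp : (ComplexShape.up ℕ).prev (m + 1) = m := by simp
      rw [hp]
      constructor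
      · rintro ⟨y, hy⟩
        obtain ⟨y, rfl⟩ := (e m).surjective y
        rw [hKd] at hy
        exact ⟨y, ((e (m + 1)).injective hy).symm⟩
      · rintro ⟨y, rfl⟩
        exact ⟨e m y, hKd m y⟩

end MatrixResolution

namespace MatrixResolution

variable {R : Type} [CommRing R] {c : ℕ} {I : Ideal R}

theorem exists_generators_of_isCanonicalIdeal (P : MatrixResolution c I) {Ω : Ideal R}
    (hΩ : IsCanonicalIdeal R c I Ω) :
    ∃ w : Fin (P.r (c + 1)) → R, (∀ v, v ⬝ᵥ w ∈ I ↔ ∃ y, v = y ᵥ* P.D c) ∧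
      Ω = I ⊔ Ideal.span (Set.range w) := by
  obtain ⟨hI, ⟨e⟩⟩ := hΩ
  obtain ⟨Φ, hΦ, hΦ'⟩ := P.exists_linearMap_extModule
  set N := Submodule.comap Ω.subtype (I : Submodule R R)
  choose w hw using fun j => N.mkQ_surjective (e.symm (Φ (Pi.single j 1)))
  have key : ∀ v, N.mkQ (∑ j, v j • w j) = e.symm (Φ v) := by
    intro v
    conv_rhs => rw [pi_eq_sum_univ' v]
    simp only [map_sum, map_smul, hw]
  have hcoe : ∀ v, ((∑ j, v j • w j : Ω) : R) = v ⬝ᵥ fun j => (w j : R) := by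
    intro v
    simp [dotProduct]
  refine ⟨fun j => w j, fun v => ?_, le_antisymm (fun x hx => ?_) (sup_le hI ?_)⟩
  · rw [← hΦ' v, ← hcoe, ← e.symm.map_eq_zero_iff, ← key, Submodule.mkQ_apply,
      Submodule.Quotient.mk_eq_zero]
    rfl
  · obtain ⟨v, hv⟩ := hΦ (e (N.mkQ ⟨x, hx⟩))
    have h := key v
    rw [hv, e.symm_apply_apply, ← sub_eq_zero, ← map_sub, Submodule.mkQ_apply,
      Submodule.Quotient.mk_eq_zero] at h
    have h : ((∑ j, v j • w j : Ω) : R) - x ∈ I := h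
    rw [← sub_sub_cancel ((∑ j, v j • w j : Ω) : R) x]
    refine sub_mem (Ideal.mem_sup_right ?_) (Ideal.mem_sup_left h)
    rw [hcoe]
    exact Ideal.sum_mem _ fun j _ => Ideal.mul_mem_left _ _ (Ideal.subset_span ⟨j, rfl⟩)
  · rw [Ideal.span_le]
    rintro _ ⟨j, rfl⟩
    exact (w j).2

theorem exists_colon_inf_colon_eq_of_isCanonicalIdeal {p : ℕ} [IsNoetherianRing R] [ExpChar R p]
    (hR : FrobeniusFlat R p) (P : MatrixResolution c I) {Ω : Ideal R}
    (hΩ : IsCanonicalIdeal R c I Ω) :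
    ∃ u : R, Submodule.colon (frobPow p I) I ⊓ Submodule.colon (frobPow p Ω) Ω =
        frobPow p I ⊔ Ideal.span {u} := by
  obtain ⟨w, hw, hΩw⟩ := P.exists_generators_of_isCanonicalIdeal hΩ
  obtain ⟨f, hf, hfI⟩ := P.exists_mem_forall_mul_mem w (Ω := Ω) (fun v => (hw v).mp) (fun j => by
    rw [hΩw]; exact Ideal.mem_sup_right (Ideal.subset_span ⟨j, rfl⟩))
  exact exists_colon_inf_colon_eq hR (IsNoetherian.noetherian I) P w hw hΩw hf hfI

end MatrixResolution

end

section

open CategoryTheory Abelian IsLocalRing RingTheory.Sequence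

theorem subsingleton_ext_of_iso {R : Type} [CommRing R] {M M' : ModuleCat.{0} R} (e : M ≅ M')
    (L : ModuleCat.{0} R) {n : ℕ}
    (h : Subsingleton (Ext M L n)) : Subsingleton (Ext M' L n) := by
  refine subsingleton_of_forall_eq 0 fun y => ?_
  rw [← Ext.mk₀_id_comp y, ← e.inv_hom_id, ← Ext.mk₀_comp_mk₀_assoc,
    Subsingleton.elim ((Ext.mk₀ e.hom).comp y (zero_add n)) 0, Ext.comp_zero]

variable {R : Type} [CommRing R] [IsLocalRing R] [IsNoetherianRing R]

theorem hasProjectiveDimensionLT_of_support_subset {rs : List R} (hrs : IsRegular R rs)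
    (hm : Ideal.ofList rs = maximalIdeal R) (M : Type) [AddCommGroup M] [Module R M]
    [Module.Finite R M]
    (hM : Module.support R M ⊆ PrimeSpectrum.zeroLocus (maximalIdeal R : Set R)) :
    HasProjectiveDimensionLT (ModuleCat.of R M) (rs.length + 1) := by
  refine IsNoetherianRing.induction_on_isQuotientEquivQuotientPrime R
    (motive := fun N _ _ _ => Module.support R N ⊆ PrimeSpectrum.zeroLocus (maximalIdeal R : Set R) →
      HasProjectiveDimensionLT (ModuleCat.of R N) (rs.length + 1)) ‹_› ?_ ?_ ?_ hM
  · intro N _ _ _ _ _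
    have := (ModuleCat.isZero_of_subsingleton (ModuleCat.of R N)).hasProjectiveDimensionLT_zero
    exact hasProjectiveDimensionLT_of_ge _ 0 _ (Nat.zero_le _)
  · intro N _ _ _ q e hN
    rw [e.support_eq, Module.support_eq_zeroLocus, Ideal.annihilator_quotient] at hN
    have hq : maximalIdeal R ≤ q.asIdeal := hN (show q ∈ PrimeSpectrum.zeroLocus _ from fun _ h => h)
    have hq' : q.asIdeal = Ideal.ofList rs := by
      rw [hm]
      exact le_antisymm (le_maximalIdeal q.2.ne_top) hq
    have h := ModuleCat.projectiveDimension_quotient_eq_length rs hrs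
    have h' : HasProjectiveDimensionLE (ModuleCat.of R (Shrink.{0} (R ⧸ Ideal.ofList rs)))
        rs.length := (projectiveDimension_le_iff _ _).mp h.le
    have h' : HasProjectiveDimensionLT (ModuleCat.of R (Shrink.{0} (R ⧸ Ideal.ofList rs)))
        (rs.length + 1) := h'
    exact hasProjectiveDimensionLT_of_iso ((Shrink.linearEquiv R (R ⧸ Ideal.ofList rs)).trans
      ((Submodule.quotEquivOfEq _ _ hq').symm.trans e.symm)).toModuleIso _
  · intro N₁ _ _ _ N₂ _ _ _ N₃ _ _ _ f g hf hg hfg h₁ h₃ hN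
    rw [Module.support_of_exact hfg hf hg, Set.union_subset_iff] at hN
    let S : ShortComplex (ModuleCat R) := ShortComplex.mk (ModuleCat.ofHom f) (ModuleCat.ofHom g)
      (ModuleCat.hom_ext (LinearMap.ext fun x => hfg.apply_apply_eq_zero x))
    have hS : S.ShortExact :=
      { exact := (ShortComplex.moduleCat_exact_iff _).mpr fun x hx => (hfg x).mp hx
        mono_f := (ModuleCat.mono_iff_injective _).mpr hf
        epi_g := (ModuleCat.epi_iff_surjective _).mpr hg }
    exact hS.hasProjectiveDimensionLT_X₂ _ (h₁ hN.1) (h₃ hN.2)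

theorem subsingleton_of_forall_exists_smul_eq {R : Type*} [CommRing R] [IsLocalRing R] {E : Type*}
    [AddCommGroup E] [Module R E] [Module.Finite R E] {x : R} (hx : x ∈ maximalIdeal R) (h : ∀ y : E, ∃ z, x • z = y) :
    Subsingleton E := by
  rw [← Submodule.subsingleton_iff R]
  refine subsingleton_iff_bot_eq_top.mp (Submodule.eq_bot_of_le_smul_of_le_jacobson_bot
    (maximalIdeal R) ⊤ Module.Finite.fg_top (fun y _ => ?_) (maximalIdeal_le_jacobson _)).symm
  obtain ⟨z, rfl⟩ := h y
  exact Submodule.smul_mem_smul hx trivial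

theorem subsingleton_ext_of_quotSMulTop (M : ModuleCat.{0} R) [Module.Finite R M] {x : R}
    (reg : IsSMulRegular M x) (mem : x ∈ maximalIdeal R) (L : ModuleCat.{0} R) [Module.Finite R L]
    (n : ℕ) (h : Subsingleton (Ext (ModuleCat.of R (QuotSMulTop x M)) L (n + 1))) :
    Subsingleton (Ext M L n) := by
  refine subsingleton_of_forall_exists_smul_eq mem fun y => ?_
  obtain ⟨z, hz⟩ := Ext.contravariant_sequence_exact₁ reg.smulShortComplex_shortExact L y
    (add_comm 1 n) (Subsingleton.elim (α := Ext (ModuleCat.of R (QuotSMulTop x M)) L (n + 1)) _ _)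
  refine ⟨z, Eq.trans ?_ hz⟩
  refine Eq.trans ?_ (congrArg (fun f => Ext.comp f z (zero_add n))
    (show x • Ext.mk₀ (𝟙 M) = Ext.mk₀ (M.smulShortComplex x).f from (Ext.mk₀_smul x (𝟙 M)).symm))
  exact (((Ext.smul_comp (Ext.mk₀ (𝟙 M)) z (zero_add n) x).trans
    (congrArg (x • ·) (Ext.mk₀_id_comp z)))).symm

theorem subsingleton_ext_of_quotient_ofList (L : ModuleCat.{0} R) [Module.Finite R L]
    (rs : List R) (M : ModuleCat.{0} R) [Module.Finite R M]
    (reg : IsWeaklyRegular M rs) (mem : ∀ r ∈ rs, r ∈ maximalIdeal R) (n : ℕ)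
    (h : Subsingleton (Ext (ModuleCat.of R (M ⧸ Ideal.ofList rs • (⊤ : Submodule R M))) L
      (n + rs.length))) :
    Subsingleton (Ext M L n) := by
  induction rs generalizing M n with
  | nil =>
    refine subsingleton_ext_of_iso (Submodule.quotEquivOfEqBot _ ?_).toModuleIso L h
    rw [Ideal.ofList_nil, Submodule.bot_smul]
  | cons x rs ih =>
    simp only [List.mem_cons, forall_eq_or_imp] at mem
    simp only [isWeaklyRegular_cons_iff] at reg
    refine subsingleton_ext_of_quotSMulTop M reg.1 mem.1 L n ?_
    refine ih (ModuleCat.of R (QuotSMulTop x M)) reg.2 mem.2 (n + 1) ?_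
    rw [List.length_cons, ← Nat.add_assoc, Nat.add_right_comm] at h
    exact subsingleton_ext_of_iso
      (Submodule.quotOfListConsSMulTopEquivQuotSMulTopInner M x rs).toModuleIso L h

end

section

open CategoryTheory Abelian IsLocalRing RingTheory.Sequence

theorem exists_list_map_mk_eq {R : Type*} [CommRing R] (I m : Ideal R) (rs : List (R ⧸ I))
    (h : ∀ x ∈ rs, x ∈ m.map (Ideal.Quotient.mk I)) :
    ∃ rs' : List R, rs'.map (Ideal.Quotient.mk I) = rs ∧ ∀ x ∈ rs', x ∈ m := by
  induction rs with
  | nil => exact ⟨[], rfl, by simp⟩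
  | cons x rs ih =>
    obtain ⟨rs', rfl, h'⟩ := ih fun y hy => h y (List.mem_cons_of_mem _ hy)
    obtain ⟨y, hy, rfl⟩ := (Ideal.mem_map_iff_of_surjective _ Ideal.Quotient.mk_surjective).mp
      (h x List.mem_cons_self)
    exact ⟨y :: rs', rfl, by simpa using ⟨hy, h'⟩⟩

variable {R : Type} [CommRing R] [IsLocalRing R] [IsNoetherianRing R]

theorem IsCohenMacaulayLocalOfDim.exists_list {I : Ideal R} {d : ℕ}
    (h : IsCohenMacaulayLocalOfDim (R ⧸ I) ((maximalIdeal R).map (Ideal.Quotient.mk I)) d) :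
    ∃ rs : List R, rs.length = d ∧ (∀ x ∈ rs, x ∈ maximalIdeal R) ∧ IsWeaklyRegular (R ⧸ I) rs ∧
      Module.support R ((R ⧸ I) ⧸ Ideal.ofList rs • (⊤ : Submodule R (R ⧸ I))) ⊆
        PrimeSpectrum.zeroLocus (maximalIdeal R : Set R) := by
  obtain ⟨hdim, rs', rfl, hmem, hreg⟩ := h
  obtain ⟨rs, rfl, hm⟩ := exists_list_map_mk_eq I _ rs' hmem
  refine ⟨rs, by simp, hm, (isWeaklyRegular_map_algebraMap_iff (R ⧸ I) (R ⧸ I) rs).mp hreg.1, ?_⟩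
  have : Nontrivial (R ⧸ I) := hreg.nontrivial
  have : IsLocalRing (R ⧸ I) := .of_surjective' _ Ideal.Quotient.mk_surjective
  set J := Ideal.ofList (rs.map (Ideal.Quotient.mk I)) with hJ
  have hzero : ringKrullDim ((R ⧸ I) ⧸ J) = 0 := by
    have h := ringKrullDim_add_length_eq_ringKrullDim_of_isRegular _ hreg
    rw [hdim] at h
    exact ENat.WithBot.add_natCast_cancel.mp (h.trans (zero_add _).symm)
  have hzero : Ring.KrullDimLE 0 ((R ⧸ I) ⧸ J) := Order.krullDimLE_iff _ _ |>.mpr hzero.le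
  let φ : R →+* (R ⧸ I) ⧸ J := (Ideal.Quotient.mk J).comp (Ideal.Quotient.mk I)
  have hφ : Function.Surjective φ :=
    Ideal.Quotient.mk_surjective.comp Ideal.Quotient.mk_surjective
  intro q hq
  have hker : RingHom.ker φ ≤ q.asIdeal := by
    refine le_trans (fun x hx => ?_) (Module.mem_support_iff_of_finite.mp hq)
    rw [Module.mem_annihilator]
    intro y
    obtain ⟨y, rfl⟩ := Submodule.mkQ_surjective _ y
    rw [← map_smul, Submodule.mkQ_apply, Submodule.Quotient.mk_eq_zero, Ideal.smul_top_eq_map]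
    have hx : Ideal.Quotient.mk I x ∈ J := Ideal.Quotient.eq_zero_iff_mem.mp hx
    rw [hJ, ← Ideal.map_ofList] at hx
    rw [Algebra.smul_def]
    exact Ideal.mul_mem_right _ _ hx
  have hp : (q.asIdeal.map φ).IsPrime := Ideal.map_isPrime_of_surjective hφ hker
  have hmax : (q.asIdeal.map φ).IsMaximal := Ring.krullDimLE_zero_iff.mp hzero _ hp
  have := Ideal.comap_isMaximal_of_surjective φ hφ (K := q.asIdeal.map φ)
  rw [Ideal.comap_map_of_surjective' φ hφ, sup_eq_left.mpr hker] at this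
  have := (IsLocalRing.isMaximal_iff R).mp this
  exact this.ge

theorem IsCohenMacaulayLocalOfDim.homological {rs : List R} (hrs : IsRegular R rs)
    (hm : Ideal.ofList rs = maximalIdeal R) {I : Ideal R} {d : ℕ}
    (h : IsCohenMacaulayLocalOfDim (R ⧸ I) ((maximalIdeal R).map (Ideal.Quotient.mk I)) d) :
    I ≠ ⊤ ∧ HasProjectiveDimensionLT (ModuleCat.of R (R ⧸ I)) (rs.length - d + 1) ∧
      ∀ i < rs.length - d, Subsingleton (Ext (ModuleCat.of R (R ⧸ I)) (ModuleCat.of R R) i) := by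
  have hI : Nontrivial (R ⧸ I) := by
    obtain ⟨_, _, _, _, hreg⟩ := h
    exact hreg.nontrivial
  obtain ⟨rs', hlen, hmem, hreg, hsupp⟩ := h.exists_list
  have hpd := hasProjectiveDimensionLT_of_support_subset hrs hm _ hsupp
  have hpd' := ModuleCat.projectiveDimension_quotient_eq_add_length_of_isWeaklyRegular
    (ModuleCat.of R (R ⧸ I)) rs' hreg hmem
  refine ⟨Ideal.Quotient.nontrivial_iff.mp hI, ?_, fun i hi => ?_⟩
  · have h1 := (projectiveDimension_le_iff _ rs.length).mpr hpd
    have h2 : projectiveDimension (ModuleCat.of R (R ⧸ I)) + (d : ℕ) ≤ (rs.length : ℕ) := by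
      rw [← hlen]
      exact hpd'.symm.le.trans h1
    refine (projectiveDimension_le_iff _ (rs.length - d)).mp
      (ENat.WithBot.add_le_add_natCast_right_iff.mp (h2.trans ?_))
    rw [← Nat.cast_add]
    exact Nat.mono_cast (by omega)
  · refine subsingleton_ext_of_quotient_ofList _ rs' (ModuleCat.of R (R ⧸ I)) hreg hmem i ?_
    refine ModuleCat.subsingleton_ext_of_exists_isRegular (maximalIdeal R) _ hsupp _ ?_ rs
      (fun r hr => ?_) hrs _ (by omega)
    · change maximalIdeal R • (⊤ : Submodule R R) < ⊤
      rw [smul_eq_mul, Ideal.mul_top]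
      exact (maximalIdeal.isMaximal R).ne_top.lt_top
    · rw [← hm]
      exact Ideal.subset_span hr

end

section

open CategoryTheory Abelian IsLocalRing

theorem exists_surjective_ker_hasProjectiveDimensionLT {R : Type} [CommRing R] [IsLocalRing R]
    [IsNoetherianRing R] (c : ℕ) (M : Type) [AddCommGroup M] [Module R M] [Module.Finite R M]
    [HasProjectiveDimensionLT (ModuleCat.of R M) (c + 1)] :
    ∃ (m : ℕ) (ε : (Fin m → R) →ₗ[R] M), Function.Surjective ε ∧
      HasProjectiveDimensionLT (ModuleCat.of R (LinearMap.ker ε)) c := by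
  cases c with
  | zero =>
    have : Module.Projective R M :=
      (IsProjective.iff_projective (R := R) M).mpr (projective_iff_hasProjectiveDimensionLT_one.mpr ‹_›)
    have : Module.Free R M := Module.free_of_flat_of_isLocalRing
    let e := (Module.finBasis R M).equivFun.symm
    refine ⟨_, e.toLinearMap, e.surjective, ?_⟩
    have : Subsingleton (LinearMap.ker e.toLinearMap) := by
      rw [LinearEquiv.ker]; infer_instance
    exact (ModuleCat.isZero_of_subsingleton _).hasProjectiveDimensionLT_zero
  | succ c =>
    obtain ⟨m, ε, hε⟩ := Module.Finite.exists_fin' R M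
    refine ⟨m, ε, hε, ?_⟩
    exact ((LinearMap.shortExact_shortComplexKer hε).hasProjectiveDimensionLT_X₃_iff c
      (inferInstanceAs (Projective (ModuleCat.of R (Fin m → R))))).mp ‹_›

theorem subsingleton_ext_ker {R : Type} [CommRing R] {M : Type} [AddCommGroup M] [Module R M]
    {m : ℕ} {ε : (Fin m → R) →ₗ[R] M} (hε : Function.Surjective ε) (L : ModuleCat.{0} R) (i : ℕ)
    (h : Subsingleton (Ext (ModuleCat.of R M) L (i + 2))) :
    Subsingleton (Ext (ModuleCat.of R (LinearMap.ker ε)) L (i + 1)) := by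
  refine subsingleton_of_forall_eq 0 fun x => ?_
  obtain ⟨y, rfl⟩ := Ext.contravariant_sequence_exact₁ (LinearMap.shortExact_shortComplexKer hε) L x
    (show 1 + (i + 1) = i + 2 by omega) (h.elim _ _)
  have : Projective ε.shortComplexKer.X₂ := inferInstanceAs (Projective (ModuleCat.of R (Fin m → R)))
  have : Subsingleton (Ext ε.shortComplexKer.X₂ L (i + 1)) := Ext.subsingleton_of_projective _ L i
  rw [Subsingleton.elim y 0, Ext.comp_zero]

theorem exists_extend_of_subsingleton_ext_one {R : Type} [CommRing R] {M : Type} [AddCommGroup M]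
    [Module R M] {m : ℕ} {ε : (Fin m → R) →ₗ[R] M} (hε : Function.Surjective ε)
    (h : Subsingleton (Ext (ModuleCat.of R M) (ModuleCat.of R R) 1))
    (φ : LinearMap.ker ε →ₗ[R] R) :
    ∃ ψ : (Fin m → R) →ₗ[R] R, ψ ∘ₗ (LinearMap.ker ε).subtype = φ := by
  obtain ⟨y, hy⟩ := Ext.contravariant_sequence_exact₁ (LinearMap.shortExact_shortComplexKer hε)
    (ModuleCat.of R R) (Ext.mk₀ (ModuleCat.ofHom φ)) (add_zero 1) (h.elim _ _)
  obtain ⟨ψ, rfl⟩ := (Ext.mk₀_bijective _ _).2 y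
  rw [Ext.mk₀_comp_mk₀, (Ext.mk₀_bijective _ _).1.eq_iff] at hy
  exact ⟨ψ.hom, congrArg ModuleCat.Hom.hom hy⟩

/-- A resolution of length less than `c` of `M` by finite free modules, exact after dualizing in
every degree where the corresponding extension module vanishes. -/
structure FreeResolution (R : Type) [CommRing R] (c : ℕ) (M : Type) [AddCommGroup M]
    [Module R M] where
  r : ℕ → ℕ
  D : ∀ i, (Fin (r (i + 1)) → R) →ₗ[R] (Fin (r i) → R)
  ε : (Fin (r 0) → R) →ₗ[R] M
  surjective : Function.Surjective ε
  exact_zero : ∀ v, ε v = 0 ↔ ∃ u, D 0 u = v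
  exact : ∀ i v, D i v = 0 ↔ ∃ u, D (i + 1) u = v
  r_eq_zero : ∀ i, c ≤ i → r i = 0
  dual_exact : ∀ i, Subsingleton (Ext (ModuleCat.of R M) (ModuleCat.of R R) (i + 1)) →
    ∀ φ : (Fin (r (i + 1)) → R) →ₗ[R] R, φ ∘ₗ D (i + 1) = 0 →
      ∃ ψ : (Fin (r i) → R) →ₗ[R] R, ψ ∘ₗ D i = φ

namespace FreeResolution

variable {R : Type} [CommRing R] {c : ℕ} {M : Type} [AddCommGroup M] [Module R M]

/-- Splicing a resolution of the kernel of a cover with the cover. -/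
def cons {m : ℕ} (ε : (Fin m → R) →ₗ[R] M) (hε : Function.Surjective ε)
    (S : FreeResolution R c (LinearMap.ker ε)) : FreeResolution R (c + 1) M where
  r i := Nat.casesOn i m S.r
  D i := Nat.casesOn i ((LinearMap.ker ε).subtype ∘ₗ S.ε) S.D
  ε := ε
  surjective := hε
  exact_zero v := by
    constructor
    · intro hv
      obtain ⟨u, hu⟩ := S.surjective ⟨v, hv⟩
      exact ⟨u, congrArg Subtype.val hu⟩
    · rintro ⟨u, rfl⟩
      exact (S.ε u).2
  exact i v := by
    cases i with
    | zero =>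
      exact Iff.trans ⟨fun h => Subtype.ext h, fun h => congrArg Subtype.val h⟩ (S.exact_zero v)
    | succ i => exact S.exact i v
  r_eq_zero i hi := by
    cases i with
    | zero => omega
    | succ i => exact S.r_eq_zero i (by omega)
  dual_exact i h φ hφ := by
    cases i with
    | zero =>
      have hker : LinearMap.ker S.ε ≤ LinearMap.ker φ := by
        intro x hx
        obtain ⟨u, rfl⟩ := (S.exact_zero x).mp hx
        exact LinearMap.congr_fun hφ u
      obtain ⟨φ', hφ'⟩ : ∃ φ' : LinearMap.ker ε →ₗ[R] R, φ' ∘ₗ S.ε = φ :=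
        ⟨(LinearMap.ker S.ε).liftQ φ hker ∘ₗ
          (S.ε.quotKerEquivOfSurjective S.surjective).symm.toLinearMap, by
          ext x
          simp⟩
      obtain ⟨ψ, rfl⟩ := exists_extend_of_subsingleton_ext_one hε h φ'
      exact ⟨ψ, hφ'⟩
    | succ i => exact S.dual_exact i (subsingleton_ext_ker hε _ i h) φ hφ

theorem nonempty_of_hasProjectiveDimensionLT (R : Type) [CommRing R] [IsLocalRing R]
    [IsNoetherianRing R] (c : ℕ) (M : Type) [AddCommGroup M] [Module R M] [Module.Finite R M]
    [HasProjectiveDimensionLT (ModuleCat.of R M) c] : Nonempty (FreeResolution R c M) := by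
  induction c generalizing M with
  | zero =>
    have : Subsingleton M := ModuleCat.isZero_iff_subsingleton.mp
      (isZero_of_hasProjectiveDimensionLT_zero (ModuleCat.of R M))
    exact ⟨fun _ => 0, fun _ => 0, 0, fun y => ⟨0, Subsingleton.elim _ _⟩,
      fun v => ⟨fun _ => ⟨0, Subsingleton.elim _ _⟩, fun _ => rfl⟩,
      fun i v => ⟨fun _ => ⟨0, Subsingleton.elim _ _⟩, fun _ => rfl⟩, fun _ _ => rfl,
      fun i _ φ _ => ⟨0, LinearMap.ext fun x => by rw [Subsingleton.elim x 0, map_zero, map_zero]⟩⟩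
  | succ c ih =>
    obtain ⟨m, ε, hε, hK⟩ := exists_surjective_ker_hasProjectiveDimensionLT (R := R) c M
    obtain ⟨S⟩ := ih (LinearMap.ker ε)
    exact ⟨S.cons ε hε⟩

end FreeResolution

end

section

open scoped Matrix

open CategoryTheory Abelian IsLocalRing

theorem hasProjectiveDimensionLT_ker_mkQ {R : Type} [CommRing R] [IsLocalRing R]
    {c : ℕ} {I : Ideal R} (hI : I ≠ ⊤) {ε : (Fin 1 → R) →ₗ[R] R ⧸ I}
    (hε : ∀ v, ε v = Ideal.Quotient.mk I (v 0)) (hε' : Function.Surjective ε)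
    (h : HasProjectiveDimensionLT (ModuleCat.of R (R ⧸ I)) (c + 1)) :
    HasProjectiveDimensionLT (ModuleCat.of R (LinearMap.ker ε)) c := by
  cases c with
  | zero =>
    have : Module.Projective R (R ⧸ I) :=
      (IsProjective.iff_projective (R := R) _).mpr (projective_iff_hasProjectiveDimensionLT_one.mpr h)
    have : Module.Free R (R ⧸ I) := Module.free_of_flat_of_isLocalRing
    have : Nontrivial (R ⧸ I) := Ideal.Quotient.nontrivial_iff.mpr hI
    have hbot : I = ⊥ := by
      rw [← Ideal.annihilator_quotient (I := I), Module.annihilator_eq_bot.mpr inferInstance]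
    have : Subsingleton (LinearMap.ker ε) := by
      refine subsingleton_of_forall_eq 0 fun v => Subtype.ext (funext fun i => ?_)
      have hv := Ideal.Quotient.eq_zero_iff_mem.mp ((hε _).symm.trans v.2)
      rw [Subsingleton.elim i 0]
      exact (Submodule.eq_bot_iff I).mp hbot _ hv
    exact (ModuleCat.isZero_of_subsingleton _).hasProjectiveDimensionLT_zero
  | succ c =>
    exact ((LinearMap.shortExact_shortComplexKer hε').hasProjectiveDimensionLT_X₃_iff c
      (inferInstanceAs (Projective (ModuleCat.of R (Fin 1 → R))))).mp h

theorem eq_zero_of_subsingleton_ext_zero {R : Type} [CommRing R] {I : Ideal R}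
    (h : Subsingleton (Ext (ModuleCat.of R (R ⧸ I)) (ModuleCat.of R R) 0)) {x : R}
    (hx : ∀ y ∈ I, y * x = 0) : x = 0 := by
  have : Subsingleton ((R ⧸ I) →ₗ[R] R) :=
    (Ext.addEquiv₀.trans (ModuleCat.homAddEquiv (M := ModuleCat.of R (R ⧸ I))
      (N := ModuleCat.of R R))).symm.subsingleton
  let f : (R ⧸ I) →ₗ[R] R := Submodule.liftQ I (LinearMap.toSpanSingleton R R x) fun y hy => hx y hy
  have : f (Submodule.Quotient.mk 1) = 0 := by rw [Subsingleton.elim f 0, LinearMap.zero_apply]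
  exact (one_smul R x).symm.trans this

theorem MatrixResolution.nonempty {R : Type} [CommRing R] [IsLocalRing R] [IsNoetherianRing R]
    {c : ℕ} {I : Ideal R} (hI : I ≠ ⊤)
    (hpd : HasProjectiveDimensionLT (ModuleCat.of R (R ⧸ I)) (c + 1))
    (hext : ∀ i < c, Subsingleton (Ext (ModuleCat.of R (R ⧸ I)) (ModuleCat.of R R) i)) :
    Nonempty (MatrixResolution c I) := by
  let ε : (Fin 1 → R) →ₗ[R] R ⧸ I := (Submodule.mkQ I).comp (LinearMap.proj 0)
  have hε : Function.Surjective ε :=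
    (Submodule.mkQ_surjective I).comp (LinearMap.proj_surjective 0)
  have := hasProjectiveDimensionLT_ker_mkQ hI (ε := ε) (fun _ => rfl) hε hpd
  obtain ⟨S'⟩ := FreeResolution.nonempty_of_hasProjectiveDimensionLT R c (LinearMap.ker ε)
  let S := S'.cons ε hε
  let r : ℕ → ℕ := fun i => Nat.casesOn i 0 S.r
  let D : ∀ i, Matrix (Fin (r i)) (Fin (r (i + 1))) R :=
    fun i => Nat.casesOn i 0 fun i => LinearMap.toMatrix' (S.D i)
  have hD : ∀ i v, D (i + 1) *ᵥ v = S.D i v := fun i v => LinearMap.toMatrix'_mulVec (S.D i) v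
  have hI_iff : ∀ x, x ∈ I ↔ ∃ u, S.D 0 u = fun _ => x := fun x => by
    rw [← S.exact_zero, ← Ideal.Quotient.eq_zero_iff_mem]
    rfl
  refine ⟨r, D, rfl, rfl, S.r_eq_zero _ le_rfl, fun i => ?_, fun i v hv => ?_, ?_,
    fun i hi x hx => ?_⟩
  · cases i with
    | zero => ext a; exact a.elim0
    | succ i =>
      refine (LinearMap.toMatrix'_comp (S.D i) (S.D (i + 1))).symm.trans ?_
      rw [show S.D i ∘ₗ S.D (i + 1) = 0 from
        LinearMap.ext fun v => (S.exact i _).mpr ⟨v, rfl⟩, map_zero]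
  · rw [hD, S.exact] at hv
    obtain ⟨u, rfl⟩ := hv
    exact ⟨u, (hD _ _).symm⟩
  · refine le_antisymm (fun x hx => ?_) (Ideal.span_le.mpr ?_)
    · obtain ⟨u, hu⟩ := (hI_iff x).mp hx
      rw [← hD] at hu
      let z : Fin (r 1) := (0 : Fin 1)
      rw [← show (D 1 *ᵥ u) z = x from congrFun hu z]
      change ∑ j, D 1 z j * u j ∈ _
      refine Ideal.sum_mem _ fun j _ => Ideal.mul_mem_right _ _ ?_
      exact Ideal.subset_span (Set.mem_range_self (z, j))
    · rintro _ ⟨⟨a, j⟩, rfl⟩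
      refine (hI_iff _).mpr ⟨Pi.single j 1, ?_⟩
      rw [← hD, Matrix.mulVec_single_one]
      funext b
      exact congrArg (fun b => D 1 b j) (Subsingleton.elim (α := Fin 1) b a)
  · cases i with
    | zero =>
      refine ⟨fun _ => 0, funext fun j =>
        Eq.trans ?_ (Fintype.sum_empty fun a : Fin 0 => (0 : R) * D 0 a j).symm⟩
      refine eq_zero_of_subsingleton_ext_zero (hext 0 hi) fun y hy => ?_
      obtain ⟨u, hu⟩ := (hI_iff y).mp hy
      have h : x ⬝ᵥ (D (0 + 1) *ᵥ u) = 0 := by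
        rw [Matrix.dotProduct_mulVec]
        exact (congrArg (· ⬝ᵥ u) hx).trans (zero_dotProduct u)
      rw [hD, hu] at h
      rw [mul_comm]
      exact (Fintype.sum_subsingleton (ι := Fin 1) (fun j => x j * y) j).symm.trans h
    | succ i =>
      have hdot : ∀ w, Fintype.linearCombination R x w = w ⬝ᵥ x := fun w => rfl
      obtain ⟨ψ, hψ⟩ := S.dual_exact i (hext (i + 1) hi) (Fintype.linearCombination R x) (by
        refine LinearMap.ext fun w => ?_
        change Fintype.linearCombination R x (S.D (i + 1) w) = 0
        rw [← hD, hdot, dotProduct_comm, Matrix.dotProduct_mulVec]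
        exact (congrArg (· ⬝ᵥ w) hx).trans (zero_dotProduct w))
      refine ⟨fun j => ψ (Pi.single j 1), funext fun a => ?_⟩
      have h := LinearMap.congr_fun hψ (Pi.single a 1)
      rw [hdot, single_one_dotProduct] at h
      rw [← h]
      change ψ (S.D i (Pi.single a 1)) = _
      rw [← hD, Matrix.mulVec_single_one, LinearMap.pi_apply_eq_sum_univ ψ]
      refine Finset.sum_congr rfl fun j _ => ?_
      rw [show (fun l => if j = l then (1 : R) else 0) = Pi.single j 1 from
        funext fun l => by simp [Pi.single_apply, eq_comm]]
      exact mul_comm _ _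

end

open MvPowerSeries in
theorem MvPowerSeries.mem_span_X_iff {σ k : Type*} [CommRing k] (T : Finset σ)
    (f : MvPowerSeries σ k) :
    f ∈ Ideal.span ((X : σ → MvPowerSeries σ k) '' (T : Set σ)) ↔
      ∀ m : σ →₀ ℕ, (∀ j ∈ T, m j = 0) → coeff m f = 0 := by
  simpa using mem_span_X_pow_iff 1 T f

open MvPowerSeries in
theorem MvPowerSeries.ofList_take_ofFn_X {n : ℕ} {k : Type*} [CommRing k] (i : ℕ) :
    Ideal.ofList ((List.ofFn (X : Fin n → MvPowerSeries (Fin n) k)).take i) =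
      Ideal.span (X '' ((Finset.univ.filter fun j : Fin n => (j : ℕ) < i : Finset (Fin n)) :
        Set (Fin n))) := by
  refine congrArg Ideal.span (Set.ext fun x => ?_)
  simp only [Set.mem_ofPred_eq, List.mem_take_iff_getElem, List.length_ofFn, List.getElem_ofFn,
    Set.mem_image, Finset.coe_filter, Finset.mem_univ, true_and]
  constructor
  · rintro ⟨j, hj, rfl⟩
    exact ⟨⟨j, by omega⟩, by simp; omega, rfl⟩
  · rintro ⟨j, hj, rfl⟩
    exact ⟨j, by omega, rfl⟩

open MvPowerSeries in
theorem MvPowerSeries.ofList_ofFn_X {n : ℕ} {k : Type*} [Field k] :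
    Ideal.ofList (List.ofFn (X : Fin n → MvPowerSeries (Fin n) k)) =
      IsLocalRing.maximalIdeal (MvPowerSeries (Fin n) k) := by
  have h := ofList_take_ofFn_X (n := n) (k := k) n
  rw [List.take_of_length_le (by simp)] at h
  ext f
  rw [h, mem_span_X_iff, mem_maximalIdeal_iff, ← coeff_zero_eq_constantCoeff_apply]
  refine ⟨fun hf => hf 0 (by simp), fun hf m hm => ?_⟩
  rwa [show m = 0 from Finsupp.ext fun j => hm j (by simp)]

open MvPowerSeries in
theorem MvPowerSeries.isRegular_ofFn_X {n : ℕ} {k : Type*} [Field k] :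
    RingTheory.Sequence.IsRegular (MvPowerSeries (Fin n) k)
      (List.ofFn (X : Fin n → MvPowerSeries (Fin n) k)) := by
  refine .of_isWeaklyRegular_of_mem_maximalIdeal _ (fun r hr => ?_) ⟨fun i hi => ?_⟩
  · rw [← ofList_ofFn_X]
    exact Ideal.subset_span hr
  · rw [isSMulRegular_quotient_iff_mem_of_smul_mem]
    intro f hf
    rw [smul_eq_mul, Ideal.mul_top, ofList_take_ofFn_X, mem_span_X_iff] at hf ⊢
    intro m hm
    rw [List.getElem_ofFn] at hf
    have hin : i < n := by simpa using hi
    have := hf (Finsupp.single ⟨i, hin⟩ 1 + m) fun j hj => by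
      have hji : (⟨i, hin⟩ : Fin n) ≠ j := fun h => by
        rw [← h] at hj
        simp at hj
      rw [Finsupp.add_apply, hm j hj, Finsupp.single_eq_of_ne hji.symm]
    rwa [smul_eq_mul, X_def, coeff_add_monomial_mul, one_mul] at this

theorem MvPowerSeries.frobeniusFlat {σ k : Type} [Finite σ] (p : ℕ) [Fact p.Prime] [Field k]
    [CharP k p] [ExpChar (MvPowerSeries σ k) p] : FrobeniusFlat (MvPowerSeries σ k) p :=
  fun U v hv => mem_span_pow_of_mulVec_eq_zero p U v hv

/-- The module `((I^{[p]} : I) ∩ (Ω^{[p]} : Ω)) / I^{[p]}` is cyclic: there is `u ∈ R`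
with `(I^{[p]} : I) ∩ (Ω^{[p]} : Ω) = I^{[p]} + (u)`. -/
theorem stmt2 (p : ℕ) (hp : p.Prime) (k : Type) [Field k] [CharP k p]
    (n d : ℕ) (hd : 1 ≤ d)
    (I : Ideal (MvPowerSeries (Fin n) k))
    (hred : IsReduced (MvPowerSeries (Fin n) k ⧸ I))
    (hCM : IsCohenMacaulayLocalOfDim (MvPowerSeries (Fin n) k ⧸ I)
      ((IsLocalRing.maximalIdeal (MvPowerSeries (Fin n) k)).map (Ideal.Quotient.mk I)) d)
    (Ω : Ideal (MvPowerSeries (Fin n) k))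
    (hΩ : IsCanonicalIdeal (MvPowerSeries (Fin n) k) (n - d) I Ω) :
    ∃ u : MvPowerSeries (Fin n) k,
      Submodule.colon (frobPow p I) I ⊓ Submodule.colon (frobPow p Ω) Ω =
        frobPow p I ⊔ Ideal.span {u} := by
  have : Fact p.Prime := ⟨hp⟩
  have : CharP (MvPowerSeries (Fin n) k) p :=
    charP_of_injective_algebraMap (algebraMap k (MvPowerSeries (Fin n) k)).injective p
  have : ExpChar (MvPowerSeries (Fin n) k) p := .prime hp
  obtain ⟨hI, hpd, hext⟩ :=
    hCM.homological MvPowerSeries.isRegular_ofFn_X MvPowerSeries.ofList_ofFn_X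
  rw [List.length_ofFn] at hpd hext
  obtain ⟨P⟩ := MatrixResolution.nonempty hI hpd hext
  exact P.exists_colon_inf_colon_eq_of_isCanonicalIdeal (MvPowerSeries.frobeniusFlat p) hΩ
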